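/- arXiv:1610.09474 — 4 statements merged into one kernel-verified Lean document; each statement's English description precedes it below -/
import Mathlib

section
/- Let k ≥ 5 be a natural number, let h_k be a nonzero homogeneous harmonic polynomial of degree k in the real variables x, y, let s ∈ {1, 2, …, k−4}, and let ρ_{k+s} be a homogeneous real polynomial of degree k+s satisfying Δ^{s+2} ρ_{k+s} = 0. Then there exist homogeneous real polynomials u, v of degree s+1 such that the map φ(x, y) = (x + u(x,y), y + v(x,y)), which is a diffeomorphism-germ at 0 ∈ ℝ², satisfies h_k ∘ φ − (h_k + ρ_{k+s}) ∈ m₂^{k+s+1}. -/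
open MvPolynomial Filter Topology

/-- The Laplacian on polynomials in two variables. -/
noncomputable def pLap (p : MvPolynomial (Fin 2) ℝ) : MvPolynomial (Fin 2) ℝ :=
  pderiv 0 (pderiv 0 p) + pderiv 1 (pderiv 1 p)

/-- The smooth function on `ℝ²` defined by a polynomial. -/
noncomputable def toFun2 (p : MvPolynomial (Fin 2) ℝ) : ℝ × ℝ → ℝ :=
  fun q => eval ![q.1, q.2] p

/-- `R` belongs to `m₂^k`: all partial derivatives of order `< k` vanish at `0`. -/
def VanishTo (k : ℕ) (R : ℝ × ℝ → ℝ) : Prop :=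
  ∀ j, j < k → iteratedFDeriv ℝ j R 0 = 0

/-- Right equivalence of function-germs at `0 ∈ ℝ²`: there is a diffeomorphism-germ
`φ : (ℝ²,0) → (ℝ²,0)` with `h₁ ∘ φ = h₂` as germs. -/
def RightEquiv (h₁ h₂ : ℝ × ℝ → ℝ) : Prop :=
  ∃ φ ψ : ℝ × ℝ → ℝ × ℝ,
    ContDiffAt ℝ (⊤ : ℕ∞) φ 0 ∧ ContDiffAt ℝ (⊤ : ℕ∞) ψ 0 ∧ φ 0 = 0 ∧ ψ 0 = 0 ∧
    (ψ ∘ φ =ᶠ[nhds 0] id) ∧ (φ ∘ ψ =ᶠ[nhds 0] id) ∧ (h₁ ∘ φ =ᶠ[nhds 0] h₂)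


/-! ### Induction on homogeneous polynomials -/

lemma monomial_fin2 {R : Type*} [CommSemiring R] (d : Fin 2 →₀ ℕ) (c : R) :
    (monomial d c : MvPolynomial (Fin 2) R) = C c * X 0 ^ d 0 * X 1 ^ d 1 := by
  rw [monomial_eq, Finsupp.prod_fintype _ _ (fun i => by simp), Fin.prod_univ_two, mul_assoc]

lemma degree_fin2 (d : Fin 2 →₀ ℕ) : d.degree = d 0 + d 1 := by
  rw [Finsupp.degree_eq_sum, Fin.sum_univ_two]

lemma homog_induction {P : ℕ → MvPolynomial (Fin 2) ℝ → Prop}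
    (h0 : ∀ n, P n 0) (hadd : ∀ n p q, P n p → P n q → P n (p + q))
    (hC : ∀ c, P 0 (C c))
    (hX : ∀ n p i, p.IsHomogeneous n → P n p → P (n + 1) (p * X i))
    {n : ℕ} {p : MvPolynomial (Fin 2) ℝ} (hp : p.IsHomogeneous n) : P n p := by
  have key : ∀ (c : ℝ) (a b : ℕ), P (a + b) (C c * X 0 ^ a * X 1 ^ b) ∧
      (C c * X 0 ^ a * X 1 ^ b : MvPolynomial (Fin 2) ℝ).IsHomogeneous (a + b) := by
    intro c a b
    have hom : (C c * X 0 ^ a * X 1 ^ b : MvPolynomial (Fin 2) ℝ).IsHomogeneous (a + b) :=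
      (isHomogeneous_C_mul_X_pow c 0 a).mul (isHomogeneous_X_pow 1 b)
    refine ⟨?_, hom⟩
    clear hom
    induction b with
    | zero =>
      induction a with
      | zero => simpa using hC c
      | succ a ih =>
        have := hX _ _ 0 (by simpa using isHomogeneous_C_mul_X_pow c (0 : Fin 2) a) ih
        simpa [pow_succ, mul_assoc] using this
    | succ b ih =>
      have := hX _ _ 1 ((isHomogeneous_C_mul_X_pow c 0 a).mul (isHomogeneous_X_pow 1 b)) ih
      simpa [pow_succ, mul_assoc, add_assoc] using this
  rw [p.as_sum]
  refine Finset.sum_induction _ (P n) (hadd n) (h0 n) ?_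
  intro d hd
  have hdeg : d 0 + d 1 = n := by
    rw [← degree_fin2]
    by_contra hcon
    exact (mem_support_iff.1 hd) (hp.coeff_eq_zero hcon)
  rw [monomial_fin2, ← hdeg]
  exact (key _ _ _).1

/-! ### Smooth functions vanishing to a given order -/

/-- Smooth and vanishing to order `N` at the origin. -/
def SV (N : ℕ) (f : ℝ × ℝ → ℝ) : Prop := ContDiff ℝ (⊤ : ℕ∞) f ∧ VanishTo N f

lemma SV.mono {M N : ℕ} {f : ℝ × ℝ → ℝ} (h : SV N f) (hMN : M ≤ N) : SV M f :=
  ⟨h.1, fun j hj => h.2 j (lt_of_lt_of_le hj hMN)⟩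

lemma SV.zero (N : ℕ) : SV N (fun _ => 0) := by
  refine ⟨contDiff_const, fun j _ => ?_⟩
  rw [iteratedFDeriv_fun_zero]; rfl

lemma SV.add {N : ℕ} {f g : ℝ × ℝ → ℝ} (hf : SV N f) (hg : SV N g) :
    SV N (fun p => f p + g p) := by
  refine ⟨hf.1.add hg.1, fun j hj => ?_⟩
  have h1 : ContDiffAt ℝ j f 0 := (hf.1.of_le (by exact_mod_cast le_top)).contDiffAt
  have h2 : ContDiffAt ℝ j g 0 := (hg.1.of_le (by exact_mod_cast le_top)).contDiffAt
  have := iteratedFDeriv_add_apply h1 h2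
  rw [hf.2 j hj, hg.2 j hj, add_zero] at this
  exact this

lemma SV.mul {M N : ℕ} {f g : ℝ × ℝ → ℝ} (hf : SV M f) (hg : SV N g) :
    SV (M + N) (fun p => f p * g p) := by
  refine ⟨hf.1.mul hg.1, fun j hj => ?_⟩
  have h := norm_iteratedFDeriv_mul_le hf.1 hg.1 0 (n := j) (by exact_mod_cast le_top)
  rw [Finset.sum_eq_zero] at h
  · exact norm_le_zero_iff.1 h
  · intro i hi
    have hi' := Finset.mem_range.1 hi
    rcases lt_or_ge i M with h1 | h1
    · rw [hf.2 i h1]; simp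
    · rw [hg.2 (j - i) (by omega)]; simp

lemma SV.of_zero {f : ℝ × ℝ → ℝ} (hf : ContDiff ℝ (⊤ : ℕ∞) f) (h0 : f 0 = 0) : SV 1 f := by
  refine ⟨hf, fun j hj => ?_⟩
  obtain rfl : j = 0 := by omega
  rw [← norm_eq_zero, norm_iteratedFDeriv_zero, h0, norm_zero]

lemma SV.smooth {f : ℝ × ℝ → ℝ} (hf : ContDiff ℝ (⊤ : ℕ∞) f) : SV 0 f :=
  ⟨hf, fun j hj => absurd hj (by omega)⟩

lemma toFun2_zero : toFun2 0 = fun _ => 0 := by funext q; simp [toFun2]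

lemma toFun2_C (c : ℝ) : toFun2 (C c) = fun _ => c := by funext q; simp [toFun2]

lemma toFun2_add (p q : MvPolynomial (Fin 2) ℝ) :
    toFun2 (p + q) = fun x => toFun2 p x + toFun2 q x := by funext x; simp [toFun2]

lemma toFun2_mul (p q : MvPolynomial (Fin 2) ℝ) :
    toFun2 (p * q) = fun x => toFun2 p x * toFun2 q x := by funext x; simp [toFun2]

lemma toFun2_X0 : toFun2 (X 0) = Prod.fst := by funext x; simp [toFun2]

lemma toFun2_X1 : toFun2 (X 1) = Prod.snd := by funext x; simp [toFun2]

lemma toFun2_X (i : Fin 2) : SV 1 (toFun2 (X i)) := by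
  fin_cases i
  · refine SV.of_zero ?_ (by simp [toFun2])
    exact toFun2_X0 ▸ contDiff_fst
  · refine SV.of_zero ?_ (by simp [toFun2])
    exact toFun2_X1 ▸ contDiff_snd

lemma SV.homog {n : ℕ} {p : MvPolynomial (Fin 2) ℝ} (hp : p.IsHomogeneous n) :
    SV n (toFun2 p) := by
  refine homog_induction (P := fun n p => SV n (toFun2 p)) ?_ ?_ ?_ ?_ hp
  · intro n
    rw [toFun2_zero]
    exact SV.zero n
  · intro n p q hp hq
    rw [toFun2_add]
    exact hp.add hq
  · intro c
    refine SV.smooth ?_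
    rw [toFun2_C]
    exact contDiff_const
  · intro n p i _ hp
    rw [toFun2_mul]
    exact hp.mul (toFun2_X i)

/-- Taylor expansion of `p (x + u, y + v)` to first order. -/
lemma taylor_SV {s : ℕ} {u v : MvPolynomial (Fin 2) ℝ} (hu : u.IsHomogeneous (s + 1))
    (hv : v.IsHomogeneous (s + 1)) {n : ℕ} {p : MvPolynomial (Fin 2) ℝ}
    (hp : p.IsHomogeneous n) :
    SV (n + 2 * s) (fun q => toFun2 p (q.1 + toFun2 u q, q.2 + toFun2 v q) -
      (toFun2 p q + toFun2 (u * pderiv 0 p + v * pderiv 1 p) q)) := by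
  refine homog_induction (P := fun n p => SV (n + 2 * s)
    (fun q => toFun2 p (q.1 + toFun2 u q, q.2 + toFun2 v q) -
      (toFun2 p q + toFun2 (u * pderiv 0 p + v * pderiv 1 p) q))) ?_ ?_ ?_ ?_ hp
  · intro n
    simpa [toFun2] using SV.zero _
  · intro n p q hp hq
    convert hp.add hq using 2
    simp only [toFun2, map_add, map_mul]
    ring
  · intro c
    simpa [toFun2] using SV.zero _
  · intro n p i hpn ih
    have hD : SV (s + 1 + (n - 1)) (toFun2 (u * pderiv 0 p + v * pderiv 1 p)) :=
      SV.homog ((hu.mul hpn.pderiv).add (hv.mul hpn.pderiv))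
    fin_cases i
    · have h1 := ih.mul ((toFun2_X 0).add ((SV.homog hu).mono (by omega)))
      have h2 := (SV.homog hu).mul hD
      have h3 := (h1.mono (M := n + 1 + 2 * s) (by omega)).add (h2.mono (by omega))
      convert h3 using 2
      simp [toFun2, pderiv_X]
      ring
    · have h1 := ih.mul ((toFun2_X 1).add ((SV.homog hv).mono (by omega)))
      have h2 := (SV.homog hv).mul hD
      have h3 := (h1.mono (M := n + 1 + 2 * s) (by omega)).add (h2.mono (by omega))
      convert h3 using 2
      simp [toFun2, pderiv_X]
      ring

lemma hasFDerivAt_zero_of_SV {f : ℝ × ℝ → ℝ} (hf : SV 2 f) :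
    HasFDerivAt f (0 : ℝ × ℝ →L[ℝ] ℝ) 0 := by
  have hd : DifferentiableAt ℝ f 0 := hf.1.contDiffAt.differentiableAt (by simp)
  have h := hd.hasFDerivAt
  have h1 : fderiv ℝ f 0 = 0 := by
    rw [← norm_eq_zero, ← norm_iteratedFDeriv_one, hf.2 1 (by omega), norm_zero]
  rwa [h1] at h

lemma exists_local_inverse {f g : ℝ × ℝ → ℝ} (hf : SV 2 f) (hg : SV 2 g) :
    ∃ ψ : ℝ × ℝ → ℝ × ℝ, ContDiffAt ℝ (⊤ : ℕ∞) ψ 0 ∧ ψ 0 = 0 ∧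
      (ψ ∘ (fun p : ℝ × ℝ => (p.1 + f p, p.2 + g p)) =ᶠ[nhds 0] id) ∧
      ((fun p : ℝ × ℝ => (p.1 + f p, p.2 + g p)) ∘ ψ =ᶠ[nhds 0] id) := by
  have val : ∀ {f : ℝ × ℝ → ℝ}, SV 2 f → f 0 = 0 := by
    intro f hf
    have := hf.2 0 (by omega)
    rwa [← norm_eq_zero, norm_iteratedFDeriv_zero, norm_eq_zero] at this
  set φ : ℝ × ℝ → ℝ × ℝ := fun p => (p.1 + f p, p.2 + g p) with hφ
  have hφ0 : φ 0 = 0 := by simp [hφ, val hf, val hg]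
  have hsm : ContDiffAt ℝ (⊤ : ℕ∞) φ 0 :=
    ((contDiff_fst.add hf.1).prodMk (contDiff_snd.add hg.1)).contDiffAt
  have hder : HasFDerivAt φ ((ContinuousLinearEquiv.refl ℝ (ℝ × ℝ) : (ℝ × ℝ) ≃L[ℝ] (ℝ × ℝ)) :
      ℝ × ℝ →L[ℝ] ℝ × ℝ) 0 := by
    have := ((hasFDerivAt_fst (𝕜 := ℝ) (p := (0 : ℝ × ℝ))).add
      (hasFDerivAt_zero_of_SV hf)).prodMk
      ((hasFDerivAt_snd (𝕜 := ℝ) (p := (0 : ℝ × ℝ))).add (hasFDerivAt_zero_of_SV hg))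
    have hid : ((ContinuousLinearMap.fst ℝ ℝ ℝ + 0).prod (ContinuousLinearMap.snd ℝ ℝ ℝ + 0)) =
        ((ContinuousLinearEquiv.refl ℝ (ℝ × ℝ) : (ℝ × ℝ) ≃L[ℝ] (ℝ × ℝ)) :
          ℝ × ℝ →L[ℝ] ℝ × ℝ) := by
      ext <;> simp
    rw [hid] at this
    exact this
  have hn : ((⊤ : ℕ∞) : WithTop ℕ∞) ≠ 0 := by simp
  have hst := hsm.hasStrictFDerivAt' hder hn
  refine ⟨hsm.localInverse hder hn, ?_, ?_, ?_, ?_⟩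
  · have := hsm.to_localInverse hder hn
    rwa [hφ0] at this
  · have := hsm.localInverse_apply_image hder hn
    rwa [hφ0] at this
  · exact hst.eventually_left_inverse
  · have := hst.eventually_right_inverse
    rw [hφ0] at this
    exact this

/-! ### Complex coordinates -/

/-- Substitution `x = (z + w) / 2`, `y = (z - w) / (2 i)`. -/
noncomputable def zSub : MvPolynomial (Fin 2) ℂ →ₐ[ℂ] MvPolynomial (Fin 2) ℂ :=
  aeval ![C (1 / 2) * (X 0 + X 1), C (-Complex.I / 2) * (X 0 - X 1)]

/-- Substitution `z = x + i y`, `w = x - i y`. -/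
noncomputable def zBack : MvPolynomial (Fin 2) ℂ →ₐ[ℂ] MvPolynomial (Fin 2) ℂ :=
  aeval ![X 0 + C Complex.I * X 1, X 0 - C Complex.I * X 1]

lemma CI_sq : (C Complex.I * C Complex.I : MvPolynomial (Fin 2) ℂ) = -1 := by
  rw [← C_mul, Complex.I_mul_I]; simp

lemma C_half : (C (1 / 2) * 2 : MvPolynomial (Fin 2) ℂ) = 1 := by
  rw [show (2 : MvPolynomial (Fin 2) ℂ) = C 2 from (map_ofNat C 2).symm, ← C_mul]; simp

lemma C_nIhalf : (C (-Complex.I / 2) : MvPolynomial (Fin 2) ℂ) = - (C Complex.I * C (1 / 2)) := by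
  rw [← C_mul, ← C_neg]; congr 1; ring

lemma zBack_zSub (p : MvPolynomial (Fin 2) ℂ) : zBack (zSub p) = p := by
  have : zBack.comp zSub = AlgHom.id ℂ _ := by
    apply MvPolynomial.algHom_ext
    intro i
    fin_cases i
    · simp only [zSub, zBack, AlgHom.comp_apply, aeval_X, algHom_C, map_mul, map_add, map_sub,
        Fin.zero_eta, Fin.mk_one, Matrix.cons_val_zero, Matrix.cons_val_one, AlgHom.id_apply,
        MvPolynomial.algebraMap_eq]
      linear_combination X 0 * C_half
    · simp only [zSub, zBack, AlgHom.comp_apply, aeval_X, algHom_C, map_mul, map_add, map_sub,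
        Fin.zero_eta, Fin.mk_one, Matrix.cons_val_zero, Matrix.cons_val_one, AlgHom.id_apply,
        MvPolynomial.algebraMap_eq]
      rw [C_nIhalf]
      linear_combination X 1 * C_half - X 1 * C (1 / 2) * 2 * CI_sq
  exact DFunLike.congr_fun this p

lemma zSub_hom {p : MvPolynomial (Fin 2) ℂ} {n : ℕ} (hp : p.IsHomogeneous n) :
    (zSub p).IsHomogeneous n := by
  have := hp.aeval (S := ℂ) (τ := Fin 2) ![C (1 / 2) * (X 0 + X 1), C (-Complex.I / 2) * (X 0 - X 1)] (n := 1)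
    (by
      intro i
      fin_cases i
      · exact ((isHomogeneous_X _ _).add (isHomogeneous_X _ _)).C_mul _
      · exact ((isHomogeneous_X _ _).sub (isHomogeneous_X _ _)).C_mul _)
  simpa [zSub] using this

lemma zBack_hom {p : MvPolynomial (Fin 2) ℂ} {n : ℕ} (hp : p.IsHomogeneous n) :
    (zBack p).IsHomogeneous n := by
  have := hp.aeval (S := ℂ) (τ := Fin 2) ![X 0 + C Complex.I * X 1, X 0 - C Complex.I * X 1] (n := 1)
    (by
      intro i
      fin_cases i
      · exact (isHomogeneous_X _ _).add ((isHomogeneous_X _ _).C_mul _)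
      · exact (isHomogeneous_X _ _).sub ((isHomogeneous_X _ _).C_mul _))
  simpa [zBack] using this

lemma pderiv0_zSub (p : MvPolynomial (Fin 2) ℂ) : pderiv 0 (zSub p) =
    C (1 / 2) * zSub (pderiv 0 p) + C (-Complex.I / 2) * zSub (pderiv 1 p) := by
  induction p using MvPolynomial.induction_on with
  | C a => simp [zSub]
  | add p q hp hq => simp only [map_add, hp, hq]; ring
  | mul_X p i hp =>
    simp only [map_mul, pderiv_mul, hp, map_add]
    fin_cases i
    · simp [zSub, pderiv_X, pderiv_C_mul]; ring
    · simp [zSub, pderiv_X, pderiv_C_mul]; ring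

lemma pderiv1_zSub (p : MvPolynomial (Fin 2) ℂ) : pderiv 1 (zSub p) =
    C (1 / 2) * zSub (pderiv 0 p) - C (-Complex.I / 2) * zSub (pderiv 1 p) := by
  induction p using MvPolynomial.induction_on with
  | C a => simp [zSub]
  | add p q hp hq => simp only [map_add, hp, hq]; ring
  | mul_X p i hp =>
    simp only [map_mul, pderiv_mul, hp, map_add]
    fin_cases i
    · simp [zSub, pderiv_X, pderiv_C_mul]; ring
    · simp [zSub, pderiv_X, pderiv_C_mul]; ring

lemma pderiv_comm01 {R : Type*} [CommRing R] (p : MvPolynomial (Fin 2) R) :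
    pderiv 0 (pderiv 1 p) = pderiv 1 (pderiv 0 p) := by
  induction p using MvPolynomial.induction_on with
  | C a => simp
  | add p q hp hq => simp only [map_add, hp, hq]
  | mul_X p i hp =>
    simp only [pderiv_mul, map_add, hp]
    fin_cases i
    · simp [pderiv_X]
    · simp [pderiv_X]

lemma map_pLap (p : MvPolynomial (Fin 2) ℝ) :
    zSub (map Complex.ofRealHom (pLap p)) =
      C 4 * pderiv 0 (pderiv 1 (zSub (map Complex.ofRealHom p))) := by
  set P := map Complex.ofRealHom p with hP
  have h1 : map Complex.ofRealHom (pLap p) = pderiv 0 (pderiv 0 P) + pderiv 1 (pderiv 1 P) := by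
    simp [pLap, hP, pderiv_map]
  have hc : (C 4 : MvPolynomial (Fin 2) ℂ) = 4 := map_ofNat C 4
  rw [h1, pderiv1_zSub, map_sub, pderiv_C_mul, pderiv_C_mul, pderiv0_zSub, pderiv0_zSub, map_add,
    pderiv_comm01, C_nIhalf, hc]
  have h2 : (C (1 / 2) * C (1 / 2) * 4 : MvPolynomial (Fin 2) ℂ) = 1 := by
    linear_combination (C (1 / 2) * 2 + 1) * C_half
  linear_combination -(zSub (pderiv 0 (pderiv 0 P))) * h2
    + (zSub (pderiv 1 (pderiv 1 P))) * (4 * C (1 / 2) * C (1 / 2) * CI_sq - h2)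

lemma coeff_vanish (m : ℕ) : ∀ p : MvPolynomial (Fin 2) ℝ, pLap^[m] p = 0 →
    ∀ d : Fin 2 →₀ ℕ, m ≤ d 0 → m ≤ d 1 → coeff d (zSub (map Complex.ofRealHom p)) = 0 := by
  induction m with
  | zero =>
    intro p hp d _ _
    simp only [Function.iterate_zero, id] at hp
    simp [hp]
  | succ m ih =>
    intro p hp d h0 h1
    rw [Function.iterate_succ_apply] at hp
    let e : Fin 2 →₀ ℕ := d - Finsupp.single 0 1 - Finsupp.single 1 1
    have he : e + Finsupp.single 0 1 + Finsupp.single 1 1 = d := by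
      ext i
      fin_cases i
      · simp [e]; omega
      · simp [e]; omega
    have h := ih _ hp e (by simp [e]; omega) (by simp [e]; omega)
    rw [map_pLap, coeff_C_mul, coeff_pderiv, coeff_pderiv, he] at h
    have hne : ∀ n : ℕ, (n : ℂ) + 1 ≠ 0 := fun n => by exact_mod_cast Nat.succ_ne_zero n
    simpa [hne] using h

lemma split_vanish {n e : ℕ} {p : MvPolynomial (Fin 2) ℂ} (hp : p.IsHomogeneous (n + e))
    (hv : ∀ d : Fin 2 →₀ ℕ, e + 1 ≤ d 0 → e + 1 ≤ d 1 → coeff d p = 0) :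
    ∃ A B : MvPolynomial (Fin 2) ℂ, A.IsHomogeneous e ∧ B.IsHomogeneous e ∧
      p = X 0 ^ n * A + X 1 ^ n * B := by
  rw [p.as_sum]
  refine Finset.sum_induction _ (fun q => ∃ A B : MvPolynomial (Fin 2) ℂ,
    A.IsHomogeneous e ∧ B.IsHomogeneous e ∧ q = X 0 ^ n * A + X 1 ^ n * B) ?_ ?_ ?_
  · rintro a b ⟨A, B, hA, hB, rfl⟩ ⟨A', B', hA', hB', rfl⟩
    exact ⟨A + A', B + B', hA.add hA', hB.add hB', by ring⟩
  · exact ⟨0, 0, isHomogeneous_zero _ _ _, isHomogeneous_zero _ _ _, by simp⟩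
  · intro d hd
    have hdeg : d 0 + d 1 = n + e := by
      rw [← degree_fin2]
      by_contra hcon
      exact (mem_support_iff.1 hd) (hp.coeff_eq_zero hcon)
    have hnot : ¬ (e + 1 ≤ d 0 ∧ e + 1 ≤ d 1) := fun h =>
      (mem_support_iff.1 hd) (hv d h.1 h.2)
    rw [monomial_fin2]
    rcases le_or_gt (d 0) e with h | h
    · refine ⟨0, C (coeff d p) * X 0 ^ d 0 * X 1 ^ (d 1 - n), isHomogeneous_zero _ _ _, ?_, ?_⟩
      · have := (isHomogeneous_C_mul_X_pow (coeff d p) (0 : Fin 2) (d 0)).mul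
          (isHomogeneous_X_pow (R := ℂ) (1 : Fin 2) (d 1 - n))
        rwa [show d 0 + (d 1 - n) = e by omega] at this
      · have : (X 1 ^ d 1 : MvPolynomial (Fin 2) ℂ) = X 1 ^ n * X 1 ^ (d 1 - n) := by
          rw [← pow_add]; congr 1; omega
        rw [this]; ring
    · refine ⟨C (coeff d p) * X 0 ^ (d 0 - n) * X 1 ^ d 1, 0, ?_, isHomogeneous_zero _ _ _, ?_⟩
      · have := (isHomogeneous_C_mul_X_pow (coeff d p) (0 : Fin 2) (d 0 - n)).mul
          (isHomogeneous_X_pow (R := ℂ) (1 : Fin 2) (d 1))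
        rwa [show (d 0 - n) + d 1 = e by omega] at this
      · have : (X 0 ^ d 0 : MvPolynomial (Fin 2) ℂ) = X 0 ^ n * X 0 ^ (d 0 - n) := by
          rw [← pow_add]; congr 1; omega
        rw [this]; ring

/-- Coefficientwise complex conjugation. -/
noncomputable abbrev cj : MvPolynomial (Fin 2) ℂ →+* MvPolynomial (Fin 2) ℂ :=
  map (starRingEnd ℂ)

lemma cj_ofReal (p : MvPolynomial (Fin 2) ℝ) :
    cj (map Complex.ofRealHom p) = map Complex.ofRealHom p := by
  rw [cj, MvPolynomial.map_map]
  have : (starRingEnd ℂ).comp Complex.ofRealHom = Complex.ofRealHom := by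
    apply RingHom.ext
    intro x
    simp
  rw [this]

lemma cj_cj (p : MvPolynomial (Fin 2) ℂ) : cj (cj p) = p := by
  rw [cj, MvPolynomial.map_map]
  have : (starRingEnd ℂ).comp (starRingEnd ℂ) = RingHom.id ℂ := by ext x; simp
  rw [this, MvPolynomial.map_id]

/-- The normal form of polyharmonic homogeneous polynomials. -/
lemma polyharmonic_form {n e : ℕ} {p : MvPolynomial (Fin 2) ℝ} (hp : p.IsHomogeneous (n + e))
    (hv : pLap^[e + 1] p = 0) :
    ∃ A : MvPolynomial (Fin 2) ℂ, A.IsHomogeneous e ∧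
      map Complex.ofRealHom p = (X 0 + C Complex.I * X 1) ^ n * A
        + (X 0 - C Complex.I * X 1) ^ n * cj A := by
  obtain ⟨A, B, hA, hB, hAB⟩ := split_vanish (zSub_hom (hp.map Complex.ofRealHom))
    (coeff_vanish (e + 1) p hv)
  have h1 : map Complex.ofRealHom p = (X 0 + C Complex.I * X 1) ^ n * zBack A
      + (X 0 - C Complex.I * X 1) ^ n * zBack B := by
    rw [← zBack_zSub (map Complex.ofRealHom p), hAB]
    simp [zBack]
  have h2 : map Complex.ofRealHom p = (X 0 - C Complex.I * X 1) ^ n * cj (zBack A)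
      + (X 0 + C Complex.I * X 1) ^ n * cj (zBack B) := by
    have := congrArg cj h1
    rw [cj_ofReal] at this
    rw [this]
    simp [← sub_eq_add_neg]
  refine ⟨C (1 / 2) * (zBack A + cj (zBack B)),
    ((zBack_hom hA).add ((zBack_hom hB).map _)).C_mul _, ?_⟩
  have h3 : cj (C (1 / 2) * (zBack A + cj (zBack B))) = C (1 / 2) * (cj (zBack A) + zBack B) := by
    have h4 : (starRingEnd ℂ) (1 / 2) = 1 / 2 := by
      have := Complex.conj_ofReal (1 / 2)
      simpa using this
    rw [map_mul, map_add, cj_cj, cj, map_C, h4]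
  rw [h3]
  linear_combination C (1 / 2) * h1 + C (1 / 2) * h2 - (map Complex.ofRealHom p) * C_half

lemma re_im_split {e : ℕ} {A : MvPolynomial (Fin 2) ℂ} (hA : A.IsHomogeneous e) :
    ∃ u v : MvPolynomial (Fin 2) ℝ, u.IsHomogeneous e ∧ v.IsHomogeneous e ∧
      A = map Complex.ofRealHom u + C Complex.I * map Complex.ofRealHom v := by
  have hdeg : ∀ d ∈ A.support, d.degree = e := by
    intro d hd
    by_contra hcon
    exact (mem_support_iff.1 hd) (hA.coeff_eq_zero hcon)
  refine ⟨∑ d ∈ A.support, monomial d (coeff d A).re, ∑ d ∈ A.support, monomial d (coeff d A).im,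
    IsHomogeneous.sum _ _ _ fun d hd => isHomogeneous_monomial _ (hdeg d hd),
    IsHomogeneous.sum _ _ _ fun d hd => isHomogeneous_monomial _ (hdeg d hd), ?_⟩
  conv_lhs => rw [A.as_sum]
  rw [map_sum, map_sum, Finset.mul_sum, ← Finset.sum_add_distrib]
  refine Finset.sum_congr rfl fun d _ => ?_
  rw [map_monomial, map_monomial, C_mul_monomial, ← map_add]
  congr 1
  simp only [Complex.ofRealHom_eq_coe]
  rw [mul_comm]
  exact (Complex.re_add_im _).symm

/-- The homological equation. -/
lemma solve_homological {k s : ℕ} (hk : 1 ≤ k) {h ρ : MvPolynomial (Fin 2) ℝ} (hne : h ≠ 0)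
    (hhom : h.IsHomogeneous k) (hharm : pLap h = 0)
    (hρhom : ρ.IsHomogeneous (k + s)) (hρker : pLap^[s + 2] ρ = 0) :
    ∃ u v : MvPolynomial (Fin 2) ℝ, u.IsHomogeneous (s + 1) ∧ v.IsHomogeneous (s + 1) ∧
      u * pderiv 0 h + v * pderiv 1 h = ρ := by
  obtain ⟨n, rfl⟩ : ∃ n, k = n + 1 := ⟨k - 1, by omega⟩
  obtain ⟨c', hc', hc⟩ := polyharmonic_form (n := n + 1) (e := 0) hhom (by simpa using hharm)
  obtain ⟨c, rfl⟩ : ∃ c : ℂ, c' = C c :=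
    ⟨_, (totalDegree_eq_zero_iff_eq_C.1 ((totalDegree_zero_iff_isHomogeneous _).2 hc'))⟩
  have hc0 : c ≠ 0 := by
    rintro rfl
    apply hne
    apply map_injective Complex.ofRealHom Complex.ofRealHom.injective
    rw [hc]
    simp
  obtain ⟨A, hA, hρA⟩ := polyharmonic_form (n := n) (e := s + 1) (p := ρ)
    (by rwa [show n + (s + 1) = n + 1 + s by omega]) hρker
  obtain ⟨u, v, hu, hv, huv⟩ := re_im_split (hA.C_mul (((n + 1 : ℕ) : ℂ) * c)⁻¹)
  refine ⟨u, v, hu, hv, ?_⟩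
  apply map_injective Complex.ofRealHom Complex.ofRealHom.injective
  have hK : (((n + 1 : ℕ) : ℂ) * c) ≠ 0 := mul_ne_zero (by exact_mod_cast Nat.succ_ne_zero n) hc0
  have hA' : A = C (((n + 1 : ℕ) : ℂ) * c) *
      (map Complex.ofRealHom u + C Complex.I * map Complex.ofRealHom v) := by
    rw [← huv, ← mul_assoc, ← C_mul, mul_inv_cancel₀ hK]; simp
  have hcA : cj A = C (((n + 1 : ℕ) : ℂ) * (starRingEnd ℂ) c) *
      (map Complex.ofRealHom u - C Complex.I * map Complex.ofRealHom v) := by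
    rw [hA', map_mul cj, map_add cj, map_mul cj (C Complex.I), cj_ofReal, cj_ofReal]
    simp [sub_eq_add_neg]
  rw [hρA, hcA, hA', map_add, map_mul, map_mul, ← pderiv_map, ← pderiv_map, hc]
  have e1 : cj (C c) = C ((starRingEnd ℂ) c) := by simp
  rw [e1]
  simp only [C_mul, map_add, map_sub, pderiv_mul, pderiv_pow, pderiv_C, pderiv_X_self,
    pderiv_X_of_ne (R := ℂ) (show (0 : Fin 2) ≠ 1 by decide),
    pderiv_X_of_ne (R := ℂ) (show (1 : Fin 2) ≠ 0 by decide), map_natCast, Nat.add_sub_cancel]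
  ring

/-- Let `k ≥ 5`, `h` a nonzero homogeneous harmonic polynomial of degree `k`,
`s ∈ {1,…,k−4}`, and `ρ` homogeneous of degree `k+s` with `Δ^{s+2} ρ = 0`. Then there are
homogeneous polynomials `u, v` of degree `s+1` such that `φ(x,y) = (x+u(x,y), y+v(x,y))` is a
diffeomorphism-germ at `0` and `h ∘ φ − (h + ρ) ∈ m₂^{k+s+1}`. -/
theorem shear_diffeo_kills_polyharmonic_term
    (k : ℕ) (hk : 5 ≤ k)
    (h : MvPolynomial (Fin 2) ℝ) (hne : h ≠ 0)
    (hhom : h.IsHomogeneous k) (hharm : pLap h = 0)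
    (s : ℕ) (hs1 : 1 ≤ s) (hs2 : s ≤ k - 4)
    (ρ : MvPolynomial (Fin 2) ℝ) (hρhom : ρ.IsHomogeneous (k + s))
    (hρker : pLap^[s + 2] ρ = 0) :
    ∃ u v : MvPolynomial (Fin 2) ℝ, u.IsHomogeneous (s + 1) ∧ v.IsHomogeneous (s + 1) ∧
      ((∃ ψ : ℝ × ℝ → ℝ × ℝ, ContDiffAt ℝ (⊤ : ℕ∞) ψ 0 ∧ ψ 0 = 0 ∧
          (ψ ∘ (fun p : ℝ × ℝ => (p.1 + toFun2 u p, p.2 + toFun2 v p)) =ᶠ[nhds 0] id) ∧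
          ((fun p : ℝ × ℝ => (p.1 + toFun2 u p, p.2 + toFun2 v p)) ∘ ψ =ᶠ[nhds 0] id)) ∧
        VanishTo (k + s + 1)
          (fun p : ℝ × ℝ => toFun2 h (p.1 + toFun2 u p, p.2 + toFun2 v p)
            - (toFun2 h p + toFun2 ρ p))) := by
  obtain ⟨u, v, hu, hv, huv⟩ :=
    solve_homological (by omega) hne hhom hharm hρhom hρker
  refine ⟨u, v, hu, hv, ?_, ?_⟩
  · exact exists_local_inverse ((SV.homog hu).mono (by omega)) ((SV.homog hv).mono (by omega))
  · have := taylor_SV hu hv hhom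
    rw [huv] at this
    exact (this.mono (by omega)).2
end

section
/- Let n and k be natural numbers and let h ∈ m_n be a smooth function-germ (ℝⁿ,0) → (ℝ,0). Suppose m_n^k ⊆ m_n·J_h + m_n^{k+1}, where J_h is the Jacobian ideal of h. Then h is k-determined: for every R ∈ m_n^{k+1}, h and h + R are right equivalent. -/
open Filter Topology

/-- `R ∈ m_n^k`: all partial derivatives of order `< k` vanish at `0`. -/
def VanishToN (n k : ℕ) (R : (Fin n → ℝ) → ℝ) : Prop :=
  ∀ j, j < k → iteratedFDeriv ℝ j R 0 = 0

/-- Right equivalence of function-germs at `0 ∈ ℝⁿ`. -/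
def RightEquivN (n : ℕ) (h₁ h₂ : (Fin n → ℝ) → ℝ) : Prop :=
  ∃ φ ψ : (Fin n → ℝ) → (Fin n → ℝ),
    ContDiffAt ℝ (⊤ : ℕ∞) φ 0 ∧ ContDiffAt ℝ (⊤ : ℕ∞) ψ 0 ∧ φ 0 = 0 ∧ ψ 0 = 0 ∧
    (ψ ∘ φ =ᶠ[nhds 0] id) ∧ (φ ∘ ψ =ᶠ[nhds 0] id) ∧ (h₁ ∘ φ =ᶠ[nhds 0] h₂)

open scoped ContDiff

/-- Smoothness of parametric integrals over `[0,1]`. -/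
theorem contDiff_parametric_aux (m : ℕ) : ∀ {H F : Type} [NormedAddCommGroup H] [NormedSpace ℝ H]
    [FiniteDimensional ℝ H] [NormedAddCommGroup F] [NormedSpace ℝ F] [CompleteSpace F]
    (a : H × ℝ → F), ContDiff ℝ m a → ContDiff ℝ m (fun x => ∫ t in (0:ℝ)..1, a (x, t)) := by
  induction m with
  | zero =>
    intro H F _ _ _ _ _ _ a ha
    simp only [Nat.cast_zero, contDiff_zero] at ha ⊢
    exact intervalIntegral.continuous_parametric_intervalIntegral_of_continuous' (by fun_prop) _ _
  | succ m ih =>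
    intro H F _ _ _ _ _ _ a ha
    have hc : Continuous a := ha.continuous
    have hd : Differentiable ℝ a := ha.differentiable (by simp)
    let a' : H × ℝ → H →L[ℝ] F := fun p => (fderiv ℝ a p).comp (ContinuousLinearMap.inl ℝ H ℝ)
    have ha' : ContDiff ℝ m a' := by
      have : ContDiff ℝ m (fderiv ℝ a) := ha.fderiv_right (by norm_cast)
      exact this.clm_comp contDiff_const
    have hc' : Continuous a' := ha'.continuous
    rw [Nat.cast_succ, contDiff_succ_iff_hasFDerivAt]
    refine ⟨fun x => ∫ t in (0:ℝ)..1, a' (x, t), ih a' ha', fun x => ?_⟩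
    have : ProperSpace H := FiniteDimensional.proper ℝ H
    obtain ⟨C, hC⟩ := ((isCompact_closedBall x 1).prod (isCompact_Icc (a := (0:ℝ)) (b := 1))).exists_bound_of_continuousOn
      hc'.continuousOn
    refine intervalIntegral.hasFDerivAt_integral_of_dominated_of_fderiv_le
      (s := Metric.closedBall x 1) (bound := fun _ => C) (F' := fun x t => a' (x, t))
      (Metric.closedBall_mem_nhds x one_pos) ?_ ?_ ?_ ?_ ?_ ?_
    · exact Eventually.of_forall fun y => (Continuous.aestronglyMeasurable (by fun_prop))
    · exact Continuous.intervalIntegrable (by fun_prop) _ _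
    · exact (Continuous.aestronglyMeasurable (by fun_prop))
    · refine Eventually.of_forall fun t ht y hy => hC (y, t) ⟨hy, ?_⟩
      rw [Set.uIoc_of_le zero_le_one] at ht
      exact ⟨ht.1.le, ht.2⟩
    · exact intervalIntegrable_const
    · refine Eventually.of_forall fun t ht y hy => ?_
      have h1 : HasFDerivAt (fun y : H => (y, t)) (ContinuousLinearMap.inl ℝ H ℝ) y :=
        hasFDerivAt_prodMk_left y t
      exact (hd (y, t)).hasFDerivAt.comp y h1

/-- A germ of class `C^m` extends to a global `C^m` function. -/
theorem exists_global_ext {E F : Type} [NormedAddCommGroup E] [NormedSpace ℝ E]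
    [FiniteDimensional ℝ E] [NormedAddCommGroup F] [NormedSpace ℝ F] {f : E → F} {m : ℕ} {x : E}
    (hf : ContDiffAt ℝ m f x) : ∃ g : E → F, ContDiff ℝ m g ∧ f =ᶠ[𝓝 x] g := by
  have hev : ∀ᶠ y in 𝓝 x, ContDiffAt ℝ m f y := hf.eventually (by simp)
  obtain ⟨ε, hε, hball⟩ := Metric.eventually_nhds_iff_ball.1 hev
  let χ : ContDiffBump x := ⟨ε / 4, ε / 2, by positivity, by linarith⟩
  refine ⟨fun y => χ y • f y, ?_, ?_⟩
  · rw [contDiff_iff_contDiffAt]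
    intro y
    by_cases hy : y ∈ Metric.ball x ε
    · exact (χ.contDiff.contDiffAt).smul (hball y hy)
    · have : (fun y => χ y • f y) =ᶠ[𝓝 y] fun _ => 0 := by
        have h2 : y ∈ (Metric.closedBall x (ε / 2))ᶜ := by
          simp only [Metric.mem_ball, not_lt, Set.mem_compl_iff, Metric.mem_closedBall,
            not_le] at hy ⊢
          linarith
        filter_upwards [Metric.isClosed_closedBall.isOpen_compl.mem_nhds h2] with z hz
        rw [χ.zero_of_le_dist, zero_smul]
        simp only [Set.mem_compl_iff, Metric.mem_closedBall, not_le] at hz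
        exact hz.le
      exact contDiffAt_const.congr_of_eventuallyEq this
  · filter_upwards [χ.eventuallyEq_one] with y hy
    simp [hy]

/-- A neighbourhood property at `0` holds along small segments. -/
theorem eventually_segment {E : Type} [NormedAddCommGroup E] [NormedSpace ℝ E] {P : E → Prop}
    (hP : ∀ᶠ x in 𝓝 (0 : E), P x) :
    ∀ᶠ p in 𝓝 (0 : E × E), ∀ t ∈ Set.Icc (0:ℝ) 1, P (p.1 + t • p.2) := by
  obtain ⟨ε, hε, hball⟩ := Metric.eventually_nhds_iff_ball.1 hP
  filter_upwards [Metric.ball_mem_nhds (0 : E × E) (half_pos hε)] with p hp t ht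
  apply hball
  rw [mem_ball_zero_iff] at hp ⊢
  have h1 := (norm_fst_le p).trans_lt hp
  have h2 := (norm_snd_le p).trans_lt hp
  calc ‖p.1 + t • p.2‖ ≤ ‖p.1‖ + ‖t • p.2‖ := norm_add_le _ _
    _ ≤ ‖p.1‖ + 1 * ‖p.2‖ := by
      rw [norm_smul, Real.norm_of_nonneg ht.1]
      gcongr
      exact ht.2
    _ < ε := by linarith

theorem hadamard {E F : Type} [NormedAddCommGroup E] [NormedSpace ℝ E]
    [FiniteDimensional ℝ E] [NormedAddCommGroup F] [NormedSpace ℝ F] [CompleteSpace F] {f : E → F}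
    (hf : ContDiffAt ℝ ∞ f 0) : ∃ G : E × E → (E →L[ℝ] F), ContDiffAt ℝ ∞ G 0 ∧
      (∀ᶠ p in 𝓝 (0 : E × E), f (p.1 + p.2) - f p.1 = G p p.2) ∧ ∀ x, G (x, 0) = fderiv ℝ f x := by
  refine ⟨fun p => ∫ t in (0:ℝ)..1, fderiv ℝ f (p.1 + t • p.2), ?_, ?_, ?_⟩
  · rw [contDiffAt_infty]
    intro m
    have h1 : ContDiffAt ℝ m (fderiv ℝ f) 0 := hf.fderiv_right (by exact_mod_cast le_top)
    obtain ⟨g, hg, hfg⟩ := exists_global_ext h1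
    have h2 : ContDiff ℝ m (fun p : E × E => ∫ t in (0:ℝ)..1, g (p.1 + t • p.2)) :=
      contDiff_parametric_aux m (fun q : (E × E) × ℝ => g (q.1.1 + q.2 • q.1.2)) (by fun_prop)
    refine h2.contDiffAt.congr_of_eventuallyEq ?_
    filter_upwards [eventually_segment hfg] with p hp
    refine intervalIntegral.integral_congr fun t ht => hp t ?_
    rwa [Set.uIcc_of_le zero_le_one] at ht
  · have h1 : ContDiffAt ℝ (1 : ℕ) f 0 := hf.of_le (by exact_mod_cast le_top)
    have hev : ∀ᶠ y in 𝓝 (0 : E), ContDiffAt ℝ (1 : ℕ) f y := h1.eventually (by simp)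
    filter_upwards [eventually_segment hev] with p hp
    have hcont : ContinuousOn (fun t : ℝ => fderiv ℝ f (p.1 + t • p.2)) (Set.uIcc 0 1) := by
      intro t ht
      rw [Set.uIcc_of_le zero_le_one] at ht
      have : ContinuousAt (fderiv ℝ f) (p.1 + t • p.2) := (hp t ht).continuousAt_fderiv (by simp)
      have h3 : ContinuousAt (fun t : ℝ => p.1 + t • p.2) t := by fun_prop
      exact (ContinuousAt.comp (f := fun t : ℝ => p.1 + t • p.2) this h3).continuousWithinAt
    rw [ContinuousLinearMap.intervalIntegral_apply hcont.intervalIntegrable]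
    have := intervalIntegral.integral_eq_sub_of_hasDerivAt (a := 0) (b := 1)
      (f := fun t : ℝ => f (p.1 + t • p.2)) (f' := fun t : ℝ => fderiv ℝ f (p.1 + t • p.2) p.2) ?_ ?_
    · rw [this]; simp
    · intro t ht
      rw [Set.uIcc_of_le zero_le_one] at ht
      have hd : HasFDerivAt f (fderiv ℝ f (p.1 + t • p.2)) (p.1 + t • p.2) :=
        ((hp t ht).differentiableAt (by simp)).hasFDerivAt
      have h4 : HasDerivAt (fun t : ℝ => p.1 + t • p.2) p.2 t := by
        simpa using ((hasDerivAt_id t).smul_const p.2).const_add p.1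
      exact hd.comp_hasDerivAt t h4
    · exact (hcont.clm_apply continuousOn_const).intervalIntegrable
  · intro x; simp

theorem clm_pi_apply {n : ℕ} {F : Type} [NormedAddCommGroup F] [NormedSpace ℝ F]
    (L : (Fin n → ℝ) →L[ℝ] F) (x : Fin n → ℝ) : L x = ∑ i, x i • L (Pi.single i 1) := by
  conv_lhs => rw [← Finset.univ_sum_single x]
  rw [map_sum]
  refine Finset.sum_congr rfl fun i _ => ?_
  rw [← map_smul]
  congr 1
  ext j
  simp [Pi.single_apply]

/-- Smooth germs at `0` as a subring of the ring of all germs. -/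
def SG (n : ℕ) : Subring (Germ (𝓝 (0 : Fin n → ℝ)) ℝ) where
  carrier := {g | ∃ f : (Fin n → ℝ) → ℝ, ContDiffAt ℝ ∞ f 0 ∧ (f : Germ (𝓝 (0 : Fin n → ℝ)) ℝ) = g}
  mul_mem' := by
    rintro _ _ ⟨f, hf, rfl⟩ ⟨g, hg, rfl⟩
    exact ⟨fun x => f x * g x, hf.mul hg, rfl⟩
  one_mem' := ⟨fun _ => 1, contDiffAt_const, rfl⟩
  add_mem' := by
    rintro _ _ ⟨f, hf, rfl⟩ ⟨g, hg, rfl⟩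
    exact ⟨fun x => f x + g x, hf.add hg, rfl⟩
  zero_mem' := ⟨fun _ => 0, contDiffAt_const, rfl⟩
  neg_mem' := by
    rintro _ ⟨f, hf, rfl⟩
    exact ⟨fun x => - f x, hf.neg, rfl⟩

/-- The ring of smooth germs at `0 ∈ ℝⁿ`. -/
def GA (n : ℕ) : Type := SG n

namespace GA

noncomputable section

variable {n : ℕ}

instance : CommRing (GA n) := inferInstanceAs (CommRing (SG n))

/-- The germ of a function. -/
def mk (f : (Fin n → ℝ) → ℝ) (hf : ContDiffAt ℝ ∞ f 0) : GA n := ⟨(f : Germ _ ℝ), f, hf, rfl⟩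

theorem mk_eq {f g : (Fin n → ℝ) → ℝ} {hf : ContDiffAt ℝ ∞ f 0} {hg : ContDiffAt ℝ ∞ g 0} :
    mk f hf = mk g hg ↔ f =ᶠ[𝓝 0] g := by
  rw [← Germ.coe_eq]
  exact Subtype.ext_iff

theorem exists_rep (a : GA n) : ∃ (f : (Fin n → ℝ) → ℝ) (hf : ContDiffAt ℝ ∞ f 0), mk f hf = a := by
  obtain ⟨_, f, hf, rfl⟩ := a
  exact ⟨f, hf, rfl⟩

/-- A representative of a germ. -/
def rep (a : GA n) : (Fin n → ℝ) → ℝ := (exists_rep a).choose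

theorem rep_smooth (a : GA n) : ContDiffAt ℝ ∞ (rep a) 0 := (exists_rep a).choose_spec.choose

theorem mk_rep (a : GA n) : mk (rep a) (rep_smooth a) = a := (exists_rep a).choose_spec.choose_spec

theorem rep_mk (f : (Fin n → ℝ) → ℝ) (hf : ContDiffAt ℝ ∞ f 0) : rep (mk f hf) =ᶠ[𝓝 0] f :=
  mk_eq.1 (mk_rep (mk f hf))

theorem mk_add {f g : (Fin n → ℝ) → ℝ} (hf : ContDiffAt ℝ ∞ f 0) (hg : ContDiffAt ℝ ∞ g 0) :
    mk f hf + mk g hg = mk (fun x => f x + g x) (hf.add hg) := rfl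

theorem mk_mul {f g : (Fin n → ℝ) → ℝ} (hf : ContDiffAt ℝ ∞ f 0) (hg : ContDiffAt ℝ ∞ g 0) :
    mk f hf * mk g hg = mk (fun x => f x * g x) (hf.mul hg) := rfl

theorem mk_zero : mk (fun _ : Fin n → ℝ => (0:ℝ)) contDiffAt_const = 0 := rfl

theorem mk_one : mk (fun _ : Fin n → ℝ => (1:ℝ)) contDiffAt_const = 1 := rfl

theorem mk_sum {ι : Type} (s : Finset ι) (f : ι → (Fin n → ℝ) → ℝ)
    (hf : ∀ i, ContDiffAt ℝ ∞ (f i) 0) :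
    ∑ i ∈ s, mk (f i) (hf i) = mk (fun x => ∑ i ∈ s, f i x)
      (ContDiffAt.sum fun i _ => hf i) := by
  classical
  induction s using Finset.induction_on with
  | empty => simp only [Finset.sum_empty]; rfl
  | insert i s hi ih =>
    rw [Finset.sum_insert hi, ih, mk_add, mk_eq]
    exact Eventually.of_forall fun x => by simp [Finset.sum_insert hi]

instance : Algebra ℝ (GA n) := RingHom.toAlgebra
  { toFun := fun c => mk (fun _ => c) contDiffAt_const
    map_one' := rfl
    map_mul' := fun _ _ => rfl
    map_zero' := rfl
    map_add' := fun _ _ => rfl }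

theorem algebraMap_eq (c : ℝ) : algebraMap ℝ (GA n) c = mk (fun _ => c) contDiffAt_const := rfl

/-- Evaluation at `0`. -/
def ev : GA n →ₐ[ℝ] ℝ where
  toFun a := rep a 0
  map_one' := (rep_mk (fun _ => 1) contDiffAt_const).eq_of_nhds
  map_zero' := (rep_mk (fun _ => 0) contDiffAt_const).eq_of_nhds
  map_mul' a b := by
    conv_lhs => rw [← mk_rep a, ← mk_rep b]
    exact (rep_mk _ ((rep_smooth a).mul (rep_smooth b))).eq_of_nhds
  map_add' a b := by
    conv_lhs => rw [← mk_rep a, ← mk_rep b]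
    exact (rep_mk _ ((rep_smooth a).add (rep_smooth b))).eq_of_nhds
  commutes' c := (rep_mk (fun _ => c) contDiffAt_const).eq_of_nhds

theorem ev_mk (f : (Fin n → ℝ) → ℝ) (hf : ContDiffAt ℝ ∞ f 0) : ev (mk f hf) = f 0 :=
  (rep_mk f hf).eq_of_nhds

theorem ev_eq (a : GA n) : ev a = rep a 0 := rfl

theorem smooth_pd {f : (Fin n → ℝ) → ℝ} (hf : ContDiffAt ℝ ∞ f 0) (i : Fin n) :
    ContDiffAt ℝ ∞ (fun p => fderiv ℝ f p (Pi.single i 1)) 0 :=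
  (hf.fderiv_right (m := ∞) (by simp)).clm_apply contDiffAt_const

theorem eventually_diff {f : (Fin n → ℝ) → ℝ} (hf : ContDiffAt ℝ ∞ f 0) :
    ∀ᶠ p in 𝓝 0, DifferentiableAt ℝ f p := by
  have h1 : ContDiffAt ℝ (1 : ℕ) f 0 := hf.of_le (by exact_mod_cast le_top)
  filter_upwards [h1.eventually (by simp)] with p hp
  exact hp.differentiableAt (by simp)

/-- Auxiliary partial derivative of germs. -/
def pd (i : Fin n) (a : GA n) : GA n :=
  mk (fun p => fderiv ℝ (rep a) p (Pi.single i 1)) (smooth_pd (rep_smooth a) i)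

theorem pd_mk (i : Fin n) (f : (Fin n → ℝ) → ℝ) (hf : ContDiffAt ℝ ∞ f 0) :
    pd i (mk f hf) = mk (fun p => fderiv ℝ f p (Pi.single i 1)) (smooth_pd hf i) := by
  rw [pd, mk_eq]
  filter_upwards [(rep_mk f hf).fderiv (𝕜 := ℝ)] with p hp
  rw [hp]

theorem pd_add (i : Fin n) (a b : GA n) : pd i (a + b) = pd i a + pd i b := by
  obtain ⟨f, hf, rfl⟩ := exists_rep a
  obtain ⟨g, hg, rfl⟩ := exists_rep b
  rw [mk_add, pd_mk, pd_mk, pd_mk, mk_add, mk_eq]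
  filter_upwards [eventually_diff hf, eventually_diff hg] with p h1 h2
  rw [fderiv_fun_add h1 h2]; rfl

theorem pd_mul (i : Fin n) (a b : GA n) : pd i (a * b) = a * pd i b + b * pd i a := by
  obtain ⟨f, hf, rfl⟩ := exists_rep a
  obtain ⟨g, hg, rfl⟩ := exists_rep b
  rw [mk_mul, pd_mk, pd_mk, pd_mk, mk_mul, mk_mul, mk_add, mk_eq]
  filter_upwards [eventually_diff hf, eventually_diff hg] with p h1 h2
  rw [fderiv_fun_mul h1 h2]; rfl

theorem pd_const (i : Fin n) (c : ℝ) : pd i (algebraMap ℝ (GA n) c) = 0 := by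
  rw [algebraMap_eq, pd_mk, ← mk_zero, mk_eq]
  exact Eventually.of_forall fun x => by simp

/-- The partial derivative as a derivation. -/
def D (i : Fin n) : Derivation ℝ (GA n) (GA n) :=
  Derivation.mk'
    { toFun := pd i
      map_add' := pd_add i
      map_smul' := fun c a => by
        rw [Algebra.smul_def, pd_mul, pd_const, RingHom.id_apply, Algebra.smul_def]; simp }
    (fun a b => pd_mul i a b)

theorem D_mk (i : Fin n) (f : (Fin n → ℝ) → ℝ) (hf : ContDiffAt ℝ ∞ f 0) :
    D i (mk f hf) = mk (fun p => fderiv ℝ f p (Pi.single i 1)) (smooth_pd hf i) := pd_mk i f hf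

/-- Coordinate germs. -/
def X (i : Fin n) : GA n := mk (fun x => x i) (by fun_prop)

theorem D_X (i j : Fin n) : D i (X j) = if i = j then 1 else 0 := by
  rw [X, D_mk]
  have : ∀ p : Fin n → ℝ, fderiv ℝ (fun x : Fin n → ℝ => x j) p (Pi.single i 1) =
      if i = j then 1 else 0 := by
    intro p
    have h : HasFDerivAt (fun x : Fin n → ℝ => x j)
      (ContinuousLinearMap.proj (R := ℝ) (φ := fun _ : Fin n => ℝ) j) p := hasFDerivAt_apply j p
    rw [h.fderiv]
    simp [Pi.single_apply, eq_comm]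
  split_ifs with h
  · rw [← mk_one, mk_eq]; exact Eventually.of_forall fun p => (this p).trans (if_pos h)
  · rw [← mk_zero, mk_eq]; exact Eventually.of_forall fun p => by simp [this, h]

/-- The maximal ideal. -/
def M (n : ℕ) : Ideal (GA n) := RingHom.ker (ev (n := n))

theorem mem_M {a : GA n} : a ∈ M n ↔ ev a = 0 := RingHom.mem_ker

theorem X_mem (i : Fin n) : X i ∈ M n := by rw [mem_M, X, ev_mk]; rfl

theorem exists_of_mem_M {a : GA n} (ha : a ∈ M n) : ∃ g : Fin n → GA n, a = ∑ i, X i * g i := by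
  obtain ⟨f, hf, rfl⟩ := exists_rep a
  rw [mem_M, ev_mk] at ha
  obtain ⟨G, hG, hG1, -⟩ := hadamard hf
  have hG' : ContDiffAt ℝ ∞ (fun x : Fin n → ℝ => G (0, x)) 0 :=
    ContDiffAt.comp (g := G) (0 : Fin n → ℝ) hG (by fun_prop)
  have hg : ∀ i : Fin n, ContDiffAt ℝ ∞ (fun x : Fin n → ℝ => G (0, x) (Pi.single i 1)) 0 :=
    fun i => hG'.clm_apply contDiffAt_const
  refine ⟨fun i => mk _ (hg i), ?_⟩
  simp only [X, mk_mul]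
  rw [mk_sum _ (fun i x => x i * G (0, x) (Pi.single i 1)) (fun i => ContDiffAt.mul (by fun_prop) (hg i)), mk_eq]
  have ht : Tendsto (fun x : Fin n → ℝ => ((0 : Fin n → ℝ), x)) (𝓝 0) (𝓝 0) := by
    have : ContinuousAt (fun x : Fin n → ℝ => ((0 : Fin n → ℝ), x)) 0 := by fun_prop
    exact this
  filter_upwards [ht.eventually hG1] with x hx
  simp only [zero_add, ha, sub_zero] at hx
  rw [hx]
  rw [clm_pi_apply]
  simp

theorem M_eq : M n = Ideal.span (Set.range X) := by
  apply le_antisymm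
  · intro a ha
    obtain ⟨g, rfl⟩ := exists_of_mem_M ha
    exact Ideal.sum_mem _ fun i _ => Ideal.mul_mem_right _ _ (Ideal.subset_span ⟨i, rfl⟩)
  · rw [Ideal.span_le]
    rintro _ ⟨i, rfl⟩
    exact X_mem i

theorem M_fg : (M n).FG := by
  rw [M_eq]
  exact Submodule.fg_span (Set.finite_range _)

theorem isUnit_of_ev {a : GA n} (ha : ev a ≠ 0) : IsUnit a := by
  obtain ⟨f, hf, rfl⟩ := exists_rep a
  rw [ev_mk] at ha
  refine IsUnit.of_mul_eq_one (mk (fun x => (f x)⁻¹) (hf.inv ha)) ?_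
  rw [mk_mul, ← mk_one, mk_eq]
  filter_upwards [hf.continuousAt.eventually_ne ha] with x hx
  exact mul_inv_cancel₀ hx

theorem M_le_jac : M n ≤ Ideal.jacobson ⊥ := by
  intro a ha
  rw [Ideal.mem_jacobson_bot]
  intro y
  apply isUnit_of_ev
  rw [mem_M] at ha
  simp [ha]

theorem sub_const_mem (a : GA n) : a - algebraMap ℝ _ (ev a) ∈ M n := by
  rw [mem_M]; simp

end

end GA

namespace GA

noncomputable section

variable {n : ℕ}

theorem derivation_pow (d : Derivation ℝ (GA n) (GA n)) (j : ℕ) :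
    ∀ a ∈ M n ^ (j + 1), d a ∈ M n ^ j := by
  induction j with
  | zero => intro a _; simp
  | succ j ih =>
    intro a ha
    rw [pow_succ] at ha
    refine Submodule.mul_induction_on ha (fun x hx y hy => ?_) (fun x y hx hy => ?_)
    · rw [d.leibniz, smul_eq_mul, smul_eq_mul]
      refine add_mem (Ideal.mul_mem_right _ _ hx) ?_
      rw [pow_succ']
      exact Ideal.mul_mem_mul hy (ih x hx)
    · rw [map_add]; exact add_mem hx hy

theorem vanish_succ {k : ℕ} {f : (Fin n → ℝ) → ℝ} (hf : ContDiffAt ℝ ∞ f 0) :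
    VanishToN n (k + 1) f ↔
      f 0 = 0 ∧ ∀ i, VanishToN n k (fun p => fderiv ℝ f p (Pi.single i 1)) := by
  have hfd : ContDiffAt ℝ ∞ (fderiv ℝ f) 0 := hf.fderiv_right (m := ∞) (by simp)
  have key : ∀ (j : ℕ) (i : Fin n) (v : Fin j → (Fin n → ℝ)),
      iteratedFDeriv ℝ j (fun p => fderiv ℝ f p (Pi.single i 1)) 0 v =
        iteratedFDeriv ℝ j (fderiv ℝ f) 0 v (Pi.single i 1) := by
    intro j i v
    have := (ContinuousLinearMap.apply ℝ ℝ (Pi.single i 1 : Fin n → ℝ)).iteratedFDeriv_comp_left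
      (f := fderiv ℝ f) (x := 0) (n := ∞) hfd (i := j) (by exact_mod_cast le_top)
    have h2 := congrArg (fun T => T v) this
    simpa using! h2
  have hz : ∀ j, iteratedFDeriv ℝ (j + 1) f 0 = 0 ↔ iteratedFDeriv ℝ j (fderiv ℝ f) 0 = 0 := by
    intro j
    rw [← norm_eq_zero, ← norm_iteratedFDeriv_fderiv, norm_eq_zero]
  constructor
  · intro h
    refine ⟨?_, fun i j hj => ?_⟩
    · have := h 0 (by omega)
      rwa [← norm_eq_zero, norm_iteratedFDeriv_zero, norm_eq_zero] at this
    · ext v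
      rw [key, (hz j).1 (h (j + 1) (by omega))]
      rfl
  · rintro ⟨h0, h⟩ j hj
    cases j with
    | zero => rwa [← norm_eq_zero, norm_iteratedFDeriv_zero, norm_eq_zero]
    | succ j =>
      rw [hz]
      ext v x
      rw [clm_pi_apply]
      simp only [← key, h _ j (by omega : j < k)]
      simp

/-- The vector field with coefficients `c`. -/
def vf (c : Fin n → GA n) : Derivation ℝ (GA n) (GA n) := ∑ i, c i • D i

theorem vf_apply (c : Fin n → GA n) (a : GA n) : vf c a = ∑ i, c i * D i a := by
  have := congrFun (map_sum (Derivation.coeFnAddMonoidHom (R := ℝ) (A := GA n) (M := GA n))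
    (fun i => c i • D i) Finset.univ) a
  rw [Finset.sum_apply] at this
  exact this

/-- The Euler derivation. -/
def euler (n : ℕ) : Derivation ℝ (GA n) (GA n) := vf X

theorem euler_apply (a : GA n) : euler n a = ∑ i, X i * D i a := by
  rw [euler, vf_apply]

theorem euler_mem (a : GA n) : euler n a ∈ M n := by
  rw [euler_apply]
  exact Ideal.sum_mem _ fun i _ => Ideal.mul_mem_right _ _ (X_mem i)

theorem euler_X (i : Fin n) : euler n (X i) = X i := by
  rw [euler_apply]; simp [D_X]

theorem euler_M {a : GA n} (ha : a ∈ M n) : euler n a - a ∈ M n ^ 2 := by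
  obtain ⟨g, rfl⟩ := exists_of_mem_M ha
  rw [map_sum, ← Finset.sum_sub_distrib]
  refine Ideal.sum_mem _ fun i _ => ?_
  rw [Derivation.leibniz, euler_X, smul_eq_mul, smul_eq_mul, mul_comm (g i), add_sub_cancel_right,
    pow_two]
  exact Ideal.mul_mem_mul (X_mem i) (euler_mem _)

theorem euler_pow (j : ℕ) : ∀ a ∈ M n ^ j, euler n a - (j : ℝ) • a ∈ M n ^ (j + 1) := by
  induction j with
  | zero => intro a _; simpa using euler_mem a
  | succ j ih =>
    intro a ha
    rw [pow_succ] at ha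
    refine Submodule.mul_induction_on ha (fun x hx y hy => ?_) (fun x y hx hy => ?_)
    · have : euler n (x * y) - ((j + 1 : ℕ) : ℝ) • (x * y) =
          x * (euler n y - y) + (euler n x - (j : ℝ) • x) * y := by
        rw [Derivation.leibniz]
        simp only [smul_eq_mul, Algebra.smul_def]
        push_cast
        ring
      rw [this]
      refine add_mem ?_ ?_
      · have := Ideal.mul_mem_mul hx (euler_M hy)
        rwa [← pow_add] at this
      · rw [pow_succ]
        exact Ideal.mul_mem_mul (ih x hx) hy
    · have : euler n (x + y) - ((j + 1 : ℕ) : ℝ) • (x + y) = (euler n x - ((j + 1 : ℕ) : ℝ) • x) +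
        (euler n y - ((j + 1 : ℕ) : ℝ) • y) := by rw [map_add, smul_add]; ring
      rw [this]; exact add_mem hx hy

theorem mem_pow_of_D (k : ℕ) {a : GA n} (ha : a ∈ M n) (hD : ∀ i, D i a ∈ M n ^ k) :
    a ∈ M n ^ (k + 1) := by
  have : ∀ j, j ≤ k → a ∈ M n ^ (j + 1) := by
    intro j
    induction j with
    | zero => intro _; simpa using ha
    | succ j ih =>
      intro hj
      have h1 := ih (by omega)
      have h2 := euler_pow (j + 1) a h1
      have h3 : euler n a ∈ M n ^ (j + 1 + 1) := by
        rw [euler_apply]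
        refine Ideal.sum_mem _ fun i _ => ?_
        rw [pow_succ']
        exact Ideal.mul_mem_mul (X_mem i) (Ideal.pow_le_pow_right hj (hD i))
      have h4 : ((j + 1 : ℕ) : ℝ) • a ∈ M n ^ (j + 1 + 1) := by
        have := sub_mem h3 h2
        rwa [sub_sub_cancel] at this
      have h5 : a = algebraMap ℝ (GA n) ((j + 1 : ℕ) : ℝ)⁻¹ * (((j + 1 : ℕ) : ℝ) • a) := by
        rw [← Algebra.smul_def, smul_smul, inv_mul_cancel₀ (by positivity), one_smul]
      rw [h5]
      exact Ideal.mul_mem_left _ _ h4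
  exact this k le_rfl

theorem vanish_iff (k : ℕ) : ∀ {f : (Fin n → ℝ) → ℝ} (hf : ContDiffAt ℝ ∞ f 0),
    VanishToN n k f ↔ mk f hf ∈ M n ^ k := by
  induction k with
  | zero => intro f hf; simp [VanishToN]
  | succ k ih =>
    intro f hf
    rw [vanish_succ hf]
    have h1 : ∀ i, VanishToN n k (fun p => fderiv ℝ f p (Pi.single i 1)) ↔
      D i (mk f hf) ∈ M n ^ k := fun i => by rw [D_mk]; exact ih (smooth_pd hf i)
    simp only [h1]
    rw [← ev_mk f hf, ← mem_M]
    constructor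
    · rintro ⟨h2, h3⟩
      exact mem_pow_of_D k h2 h3
    · intro h
      exact ⟨Ideal.pow_le_self (by omega) h, fun i => derivation_pow _ k _ h⟩

/-- Pull-back of germs along a smooth map-germ. -/
def pull (φ : (Fin n → ℝ) → (Fin n → ℝ)) (hφ : ContDiffAt ℝ ∞ φ 0) (h0 : φ 0 = 0) :
    GA n →ₐ[ℝ] GA n :=
  have hc : ∀ {f : (Fin n → ℝ) → ℝ} (_ : ContDiffAt ℝ ∞ f 0), ContDiffAt ℝ ∞ (fun x => f (φ x)) 0 :=
    fun {f} hf => ContDiffAt.comp (g := f) (0 : Fin n → ℝ) (by rwa [h0]) hφ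
  have ht : Tendsto φ (𝓝 0) (𝓝 0) := by
    have := hφ.continuousAt.tendsto; rwa [h0] at this
  { toFun := fun a => mk (fun x => rep a (φ x)) (hc (rep_smooth a))
    map_one' := (mk_eq (hg := contDiffAt_const)).2 (ht.eventually (rep_mk (fun _ => 1) contDiffAt_const))
    map_zero' := (mk_eq (hg := contDiffAt_const)).2 (ht.eventually (rep_mk (fun _ => 0) contDiffAt_const))
    map_mul' := fun a b => by
      rw [mk_mul, mk_eq]
      conv_lhs => rw [← mk_rep a, ← mk_rep b, mk_mul]
      exact (ht.eventually (rep_mk _ ((rep_smooth a).mul (rep_smooth b))))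
    map_add' := fun a b => by
      rw [mk_add, mk_eq]
      conv_lhs => rw [← mk_rep a, ← mk_rep b, mk_add]
      exact (ht.eventually (rep_mk _ ((rep_smooth a).add (rep_smooth b))))
    commutes' := fun c => (mk_eq (hg := contDiffAt_const)).2 (ht.eventually (rep_mk (fun _ => c) contDiffAt_const)) }

theorem smooth_comp {φ : (Fin n → ℝ) → (Fin n → ℝ)} (hφ : ContDiffAt ℝ ∞ φ 0) (h0 : φ 0 = 0)
    {f : (Fin n → ℝ) → ℝ} (hf : ContDiffAt ℝ ∞ f 0) : ContDiffAt ℝ ∞ (fun x => f (φ x)) 0 :=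
  ContDiffAt.comp (g := f) (0 : Fin n → ℝ) (by rwa [h0]) hφ

theorem pull_mk {φ : (Fin n → ℝ) → (Fin n → ℝ)} (hφ : ContDiffAt ℝ ∞ φ 0) (h0 : φ 0 = 0)
    {f : (Fin n → ℝ) → ℝ} (hf : ContDiffAt ℝ ∞ f 0) :
    pull φ hφ h0 (mk f hf) = mk (fun x => f (φ x)) (smooth_comp hφ h0 hf) := by
  have ht : Tendsto φ (𝓝 0) (𝓝 0) := by
    have := hφ.continuousAt.tendsto; rwa [h0] at this
  exact (mk_eq (hf := smooth_comp hφ h0 (rep_smooth _))).2 (ht.eventually (rep_mk f hf))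

theorem pull_X {φ : (Fin n → ℝ) → (Fin n → ℝ)} (hφ : ContDiffAt ℝ ∞ φ 0) (h0 : φ 0 = 0)
    (i : Fin n) : pull φ hφ h0 (X i) = mk (fun x => φ x i) (contDiffAt_pi.1 hφ i) := by
  rw [X, pull_mk]

theorem pull_M_pow {φ : (Fin n → ℝ) → (Fin n → ℝ)} (hφ : ContDiffAt ℝ ∞ φ 0) (h0 : φ 0 = 0)
    (j : ℕ) {a : GA n} (ha : a ∈ M n ^ j) : pull φ hφ h0 a ∈ M n ^ j := by
  have h1 : (M n).map (pull φ hφ h0) ≤ M n := by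
    rw [Ideal.map_le_iff_le_comap]
    intro a ha
    obtain ⟨f, hf, rfl⟩ := exists_rep a
    rw [Ideal.mem_comap, pull_mk, mem_M, ev_mk, h0]
    rwa [mem_M, ev_mk] at ha
  have h2 := Ideal.mem_map_of_mem (pull φ hφ h0) ha
  rw [Ideal.map_pow] at h2
  exact Ideal.pow_right_mono h1 j h2

end

end GA

namespace GA

noncomputable section

variable {n : ℕ}

theorem exists_approx (S : Subalgebra ℝ (GA n)) (hX : ∀ i, X i ∈ S) (j : ℕ) :
    ∀ a : GA n, ∃ s ∈ S, a - s ∈ M n ^ j := by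
  induction j with
  | zero => intro a; exact ⟨0, S.zero_mem, by simp⟩
  | succ j ih =>
    intro a
    obtain ⟨g, hg⟩ := exists_of_mem_M (sub_const_mem a)
    choose s hs hs' using ih
    refine ⟨algebraMap ℝ _ (ev a) + ∑ i, X i * s (g i), ?_, ?_⟩
    · exact add_mem (S.algebraMap_mem _) (sum_mem fun i _ => mul_mem (hX i) (hs _))
    · rw [← sub_sub, hg, ← Finset.sum_sub_distrib]
      refine Ideal.sum_mem _ fun i _ => ?_
      rw [← mul_sub, pow_succ']
      exact Ideal.mul_mem_mul (X_mem i) (hs' _)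

theorem vf_mem {c : Fin n → GA n} (hc : ∀ i, c i ∈ M n ^ 2) (a : GA n) : vf c a ∈ M n ^ 2 := by
  rw [vf_apply]
  exact Ideal.sum_mem _ fun i _ => Ideal.mul_mem_right _ _ (hc i)

theorem vf_pow {c : Fin n → GA n} (hc : ∀ i, c i ∈ M n ^ 2) (j : ℕ) {a : GA n}
    (ha : a ∈ M n ^ j) : vf c a ∈ M n ^ (j + 1) := by
  cases j with
  | zero => exact Ideal.pow_le_pow_right (by omega) (vf_mem hc a)
  | succ j =>
    rw [vf_apply]
    refine Ideal.sum_mem _ fun i _ => ?_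
    have := Ideal.mul_mem_mul (hc i) (derivation_pow (D i) j a ha)
    rw [← pow_add] at this
    exact Ideal.pow_le_pow_right (by omega) this

theorem vf_iter {c : Fin n → GA n} (hc : ∀ i, c i ∈ M n ^ 2) (j p : ℕ) {a : GA n}
    (ha : a ∈ M n ^ j) : (vf c)^[p] a ∈ M n ^ (j + p) := by
  induction p with
  | zero => simpa using ha
  | succ p ih =>
    rw [Function.iterate_succ_apply', ← add_assoc]
    exact vf_pow hc _ ih

/-- Truncated exponential of a vector field. -/
def texp (N : ℕ) (c : Fin n → GA n) (a : GA n) : GA n :=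
  ∑ p ∈ Finset.range N, ((p.factorial : ℝ)⁻¹) • (vf c)^[p] a

/-- The induced endomorphism on the jet algebra. -/
def jetD (N : ℕ) (c : Fin n → GA n) (hc : ∀ i, c i ∈ M n ^ 2) :
    (GA n ⧸ M n ^ N) →ₗ[ℝ] (GA n ⧸ M n ^ N) :=
  have key : ∀ a b : GA n, Ideal.Quotient.mk (M n ^ N) a = Ideal.Quotient.mk (M n ^ N) b →
      Ideal.Quotient.mk (M n ^ N) (vf c a) = Ideal.Quotient.mk (M n ^ N) (vf c b) := by
    intro a b hab
    rw [Ideal.Quotient.eq] at hab ⊢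
    rw [← map_sub]
    exact Ideal.pow_le_pow_right (Nat.le_succ N) (vf_pow hc N hab)
  { toFun := fun q => Ideal.Quotient.mk (M n ^ N) (vf c (Quotient.out q))
    map_add' := fun q r => by
      rw [← map_add, ← map_add]
      apply key
      rw [map_add]
      simp [Ideal.Quotient.mk_out]
    map_smul' := fun t q => by
      rw [RingHom.id_apply, Algebra.smul_def, Algebra.smul_def, IsScalarTower.algebraMap_apply ℝ (GA n),
        Ideal.Quotient.algebraMap_eq, ← map_mul, ← Algebra.smul_def, ← (vf c).map_smul]
      apply key
      rw [Algebra.smul_def, map_mul]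
      simp [Ideal.Quotient.mk_out] }

theorem jetD_mk (N : ℕ) (c : Fin n → GA n) (hc : ∀ i, c i ∈ M n ^ 2) (a : GA n) :
    jetD N c hc (Ideal.Quotient.mk _ a) = Ideal.Quotient.mk _ (vf c a) := by
  change Ideal.Quotient.mk (M n ^ N) (vf c (Quotient.out (Ideal.Quotient.mk (M n ^ N) a))) = _
  rw [Ideal.Quotient.eq, ← map_sub]
  refine Ideal.pow_le_pow_right (Nat.le_succ N) (vf_pow hc N ?_)
  rw [← Ideal.Quotient.eq]
  simp [Ideal.Quotient.mk_out]

theorem jetD_iter (N : ℕ) (c : Fin n → GA n) (hc : ∀ i, c i ∈ M n ^ 2) (p : ℕ) (a : GA n) :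
    (jetD N c hc ^ p) (Ideal.Quotient.mk _ a) = Ideal.Quotient.mk _ ((vf c)^[p] a) := by
  induction p with
  | zero => rfl
  | succ p ih =>
    rw [pow_succ', Module.End.mul_apply, ih, jetD_mk, Function.iterate_succ_apply']

theorem jetD_nil (N : ℕ) (c : Fin n → GA n) (hc : ∀ i, c i ∈ M n ^ 2) : jetD N c hc ^ N = 0 := by
  refine LinearMap.ext fun q => ?_
  obtain ⟨a, rfl⟩ := Ideal.Quotient.mk_surjective q
  rw [jetD_iter, LinearMap.zero_apply, Ideal.Quotient.eq_zero_iff_mem]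
  have := vf_iter hc 0 N (a := a) (by simp)
  rwa [zero_add] at this

theorem exists_jet_exp (N : ℕ) (c : Fin n → GA n) (hc : ∀ i, c i ∈ M n ^ 2) :
    ∃ e : (GA n ⧸ M n ^ N) →ₐ[ℝ] (GA n ⧸ M n ^ N), ∀ a,
      e (Ideal.Quotient.mk _ a) = Ideal.Quotient.mk _ (texp N c a) := by
  let _ : Module ℚ (GA n ⧸ M n ^ N) := Module.compHom _ (algebraMap ℚ ℝ)
  have hnil := jetD_nil N c hc
  have h1 : ∀ a, IsNilpotent.exp (jetD N c hc) (Ideal.Quotient.mk _ a) =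
      Ideal.Quotient.mk _ (texp N c a) := by
    intro a
    rw [IsNilpotent.exp_eq_sum hnil, texp, map_sum, LinearMap.sum_apply]
    refine Finset.sum_congr rfl fun p _ => ?_
    rw [LinearMap.smul_apply, jetD_iter, ← Rat.cast_smul_eq_qsmul ℝ]
    push_cast
    rfl
  have hone : IsNilpotent.exp (jetD N c hc) 1 = 1 := by
    rw [← map_one (Ideal.Quotient.mk (M n ^ N)), h1]
    cases N with
    | zero => rw [Ideal.Quotient.eq]; simp
    | succ N =>
      congr 1
      rw [texp, Finset.sum_range_succ', Finset.sum_eq_zero]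
      · simp
      · intro p _
        have : ∀ p : ℕ, (vf c)^[p] (0 : GA n) = 0 := by
          intro p
          induction p with
          | zero => rfl
          | succ p ih => rw [Function.iterate_succ_apply', ih, map_zero]
        rw [Function.iterate_succ_apply, Derivation.map_one_eq_zero, this, smul_zero]
  have hmul := Module.End.exp_mul_of_derivation ℝ (GA n ⧸ M n ^ N) (jetD N c hc) (by
    intro x y
    obtain ⟨a, rfl⟩ := Ideal.Quotient.mk_surjective x
    obtain ⟨b, rfl⟩ := Ideal.Quotient.mk_surjective y
    rw [← map_mul, jetD_mk, jetD_mk, jetD_mk, Derivation.leibniz]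
    simp only [smul_eq_mul, map_add, map_mul]
    ring) ⟨N, hnil⟩
  exact ⟨AlgHom.ofLinearMap (IsNilpotent.exp (jetD N c hc)) hone hmul, h1⟩

/-- A tangent-to-identity map-germ. -/
structure TMap (n : ℕ) where
  f : (Fin n → ℝ) → (Fin n → ℝ)
  smooth : ContDiffAt ℝ ∞ f 0
  zero : f 0 = 0
  tangent : ∀ i, pull f smooth zero (X i) - X i ∈ M n ^ 2

/-- Build a tangent-to-identity map from its components. -/
theorem exists_TMap (b : Fin n → GA n) (hb : ∀ i, b i - X i ∈ M n ^ 2) :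
    ∃ φ : TMap n, ∀ i, pull φ.f φ.smooth φ.zero (X i) = b i := by
  have hs : ContDiffAt ℝ ∞ (fun x i => rep (b i) x) 0 := contDiffAt_pi.2 fun i => rep_smooth _
  have h0 : (fun x i => rep (b i) x) 0 = (0 : Fin n → ℝ) := by
    ext i
    have h1 : b i ∈ M n := by
      have := add_mem (Ideal.pow_le_self two_ne_zero (hb i)) (X_mem i)
      simpa using this
    rw [mem_M, ev_eq] at h1
    exact h1
  have hX : ∀ i, pull _ hs h0 (X i) = b i := by
    intro i
    rw [pull_X]
    exact mk_rep (b i)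
  exact ⟨⟨_, hs, h0, fun i => by rw [hX]; exact hb i⟩, hX⟩

theorem exists_exp (N : ℕ) (c : Fin n → GA n) (hc : ∀ i, c i ∈ M n ^ 2) :
    ∃ φ : TMap n, ∀ a, pull φ.f φ.smooth φ.zero a - texp (N + 1) c a ∈ M n ^ (N + 1) := by
  obtain ⟨φ, hφ⟩ := exists_TMap (fun i => texp (N + 1) c (X i)) (by
    intro i
    rw [texp, Finset.sum_range_succ']
    simp only [Nat.factorial_zero, Nat.cast_one, inv_one, one_smul, Function.iterate_zero, id_eq,
      add_sub_cancel_right]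
    refine Ideal.sum_mem _ fun p _ => ?_
    rw [Algebra.smul_def]
    apply Ideal.mul_mem_left
    rw [Function.iterate_succ_apply]
    exact Ideal.pow_le_pow_right (by omega) (vf_iter hc 2 p (vf_mem hc _)))
  obtain ⟨e, he⟩ := exists_jet_exp (N + 1) c hc
  refine ⟨φ, ?_⟩
  let π : GA n →ₐ[ℝ] (GA n ⧸ M n ^ (N + 1)) := Ideal.Quotient.mkₐ ℝ (M n ^ (N + 1))
  let S : Subalgebra ℝ (GA n) := AlgHom.equalizer (π.comp (pull φ.f φ.smooth φ.zero)) (e.comp π)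
  have hS : ∀ a, a ∈ S ↔ Ideal.Quotient.mk (M n ^ (N + 1)) (pull φ.f φ.smooth φ.zero a) =
      e (Ideal.Quotient.mk _ a) := fun a => Iff.rfl
  intro a
  rw [← Ideal.Quotient.eq, ← he, ← hS]
  obtain ⟨s, hs, has⟩ := exists_approx S (fun i => by rw [hS, hφ, he]) (N + 1) a
  have h2 : a - s ∈ S := by
    rw [hS, Ideal.Quotient.eq_zero_iff_mem.2 has, map_zero, Ideal.Quotient.eq_zero_iff_mem]
    exact pull_M_pow _ _ _ has
  have := add_mem h2 hs
  simpa using this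

theorem exp_step (j : ℕ) (h : GA n) (c : Fin n → GA n) (hc : ∀ i, c i ∈ M n ^ 2)
    (hR : vf c h ∈ M n ^ (j + 1)) :
    ∃ φ : TMap n, pull φ.f φ.smooth φ.zero h - (h + vf c h) ∈ M n ^ (j + 2) := by
  obtain ⟨φ, hφ⟩ := exists_exp (j + 1) c hc
  refine ⟨φ, ?_⟩
  have h1 : texp (j + 1 + 1) c h - (h + vf c h) ∈ M n ^ (j + 2) := by
    rw [texp, Finset.sum_range_succ', Finset.sum_range_succ']
    have : ∀ S : GA n, S + (((0 + 1 : ℕ).factorial : ℝ)⁻¹) • (vf c)^[0 + 1] h +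
      (((0 : ℕ).factorial : ℝ)⁻¹) • (vf c)^[0] h - (h + vf c h) = S := by
      intro S; simp; ring
    rw [this]
    refine Ideal.sum_mem _ fun p _ => ?_
    rw [Algebra.smul_def]
    apply Ideal.mul_mem_left
    rw [Function.iterate_succ_apply]
    exact Ideal.pow_le_pow_right (by omega) (vf_iter hc (j + 1) (p + 1) hR)
  have := add_mem (hφ h) h1
  simpa using this

end

end GA

theorem sum_identity {n : ℕ} (Y β : Fin n → Fin n → ℝ) (d : Fin n → ℝ) :
    ∑ p, (∑ i, Y p i * d i) * d p + ∑ p, ∑ q, (∑ i, Y p i * d i) * ((∑ j, Y q j * d j) * β p q) =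
      ∑ i, ∑ j, (Y i j + ∑ p, ∑ q, Y p i * Y q j * β p q) * d i * d j := by
  simp only [add_mul, Finset.sum_add_distrib]
  congr 1
  · refine Finset.sum_congr rfl fun i _ => ?_
    rw [Finset.sum_mul]
    exact Finset.sum_congr rfl fun j _ => by ring
  · simp only [Finset.sum_mul, Finset.mul_sum]
    calc ∑ p, ∑ q, ∑ i, ∑ j, Y p j * d j * (Y q i * d i * β p q)
        = ∑ p, ∑ q, ∑ j, ∑ i, Y p j * d j * (Y q i * d i * β p q) := by
          refine Finset.sum_congr rfl fun p _ => Finset.sum_congr rfl fun q _ => Finset.sum_comm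
      _ = ∑ p, ∑ j, ∑ q, ∑ i, Y p j * d j * (Y q i * d i * β p q) := by
          refine Finset.sum_congr rfl fun p _ => Finset.sum_comm
      _ = ∑ j, ∑ p, ∑ q, ∑ i, Y p j * d j * (Y q i * d i * β p q) := Finset.sum_comm
      _ = ∑ j, ∑ p, ∑ i, ∑ q, Y p j * d j * (Y q i * d i * β p q) := by
          refine Finset.sum_congr rfl fun p _ => Finset.sum_congr rfl fun q _ => Finset.sum_comm
      _ = ∑ j, ∑ i, ∑ p, ∑ q, Y p j * d j * (Y q i * d i * β p q) := by
          refine Finset.sum_congr rfl fun p _ => Finset.sum_comm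
      _ = _ := by
          refine Finset.sum_congr rfl fun p _ => Finset.sum_congr rfl fun q _ =>
            Finset.sum_congr rfl fun r _ => Finset.sum_congr rfl fun s _ => by ring

/-- Second order Hadamard expansion. -/
theorem hadamard_two {n : ℕ} {f : (Fin n → ℝ) → ℝ} (hf : ContDiffAt ℝ ∞ f 0) :
    ∃ β : Fin n → Fin n → ((Fin n → ℝ) × (Fin n → ℝ)) → ℝ, (∀ p q, ContDiffAt ℝ ∞ (β p q) 0) ∧
      ∀ᶠ z in 𝓝 (0 : (Fin n → ℝ) × (Fin n → ℝ)), f (z.1 + z.2) = f z.1 +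
        (∑ p, z.2 p * fderiv ℝ f z.1 (Pi.single p 1) + ∑ p, ∑ q, z.2 p * (z.2 q * β p q z)) := by
  obtain ⟨G, hG, hG1, hG2⟩ := hadamard hf
  obtain ⟨B, hB, hB1, -⟩ := hadamard hG
  let ℓ : ((Fin n → ℝ) × (Fin n → ℝ)) → (((Fin n → ℝ) × (Fin n → ℝ)) × ((Fin n → ℝ) × (Fin n → ℝ))) :=
    fun z => ((z.1, 0), (0, z.2))
  have hℓ : ContDiff ℝ ∞ ℓ := by fun_prop
  have hℓ0 : ℓ 0 = 0 := rfl
  have hBℓ : ContDiffAt ℝ ∞ (fun z => B (ℓ z)) 0 :=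
    ContDiffAt.comp (g := B) _ (by rwa [hℓ0]) hℓ.contDiffAt
  refine ⟨fun p q z => B (ℓ z) (0, Pi.single p 1) (Pi.single q 1),
    fun p q => (hBℓ.clm_apply contDiffAt_const).clm_apply contDiffAt_const, ?_⟩
  have ht : Tendsto ℓ (𝓝 0) (𝓝 0) := hℓ.continuous.tendsto' _ _ hℓ0
  filter_upwards [hG1, ht.eventually hB1] with z h1 h2
  have h3 : G z = fderiv ℝ f z.1 + B (ℓ z) (0, z.2) := by
    rw [← hG2, ← h2]
    simp [ℓ]
  rw [← sub_eq_iff_eq_add', h1, h3, add_apply, clm_pi_apply (fderiv ℝ f z.1)]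
  congr 1
  have h4 : B (ℓ z) (0, z.2) = ∑ p, z.2 p • B (ℓ z) (0, Pi.single p 1) := by
    have := clm_pi_apply ((B (ℓ z)).comp (ContinuousLinearMap.inr ℝ (Fin n → ℝ) (Fin n → ℝ))) z.2
    simpa using this
  rw [h4, sum_apply]
  refine Finset.sum_congr rfl fun p _ => ?_
  rw [smul_apply, clm_pi_apply (B (ℓ z) (0, Pi.single p 1)) z.2, smul_eq_mul,
    Finset.mul_sum]
  rfl

set_option maxHeartbeats 2000000 in
/-- Implicit function theorem for the Tougeron system. -/
theorem exists_matrix {n : ℕ} (d : Fin n → (Fin n → ℝ) → ℝ) (hd : ∀ i, ContDiffAt ℝ ∞ (d i) 0)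
    (β : Fin n → Fin n → ((Fin n → ℝ) × (Fin n → ℝ)) → ℝ) (hβ : ∀ p q, ContDiffAt ℝ ∞ (β p q) 0)
    (ρ : Fin n → Fin n → (Fin n → ℝ) → ℝ) (hρ : ∀ i j, ContDiffAt ℝ ∞ (ρ i j) 0)
    (hρ0 : ∀ i j, ρ i j 0 = 0) :
    ∃ Y : (Fin n → ℝ) → (Fin n → Fin n → ℝ), ContDiffAt ℝ ∞ Y 0 ∧ Y 0 = 0 ∧
      ∀ᶠ x in 𝓝 (0 : Fin n → ℝ), ∀ i j, ρ i j x = Y x i j +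
        ∑ p, ∑ q, Y x p i * Y x q j * β p q (x, fun p => ∑ i, Y x p i * d i x) := by
  let U : (Fin n → ℝ) × (Fin n → Fin n → ℝ) → (Fin n → ℝ) × (Fin n → ℝ) := fun z =>
    (z.1, fun p => ∑ i, z.2 p i * d i z.1)
  let F : (Fin n → ℝ) × (Fin n → Fin n → ℝ) → (Fin n → Fin n → ℝ) := fun z i j => z.2 i j +
    ∑ p, ∑ q, z.2 p i * (z.2 q j * β p q (U z)) - ρ i j z.1
  have hent : ∀ p i, ContDiffAt ℝ ∞ (fun z : (Fin n → ℝ) × (Fin n → Fin n → ℝ) => z.2 p i) 0 := fun p i => by fun_prop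
  have hfst : ∀ {g : (Fin n → ℝ) → ℝ}, ContDiffAt ℝ ∞ g 0 →
      ContDiffAt ℝ ∞ (fun z : (Fin n → ℝ) × (Fin n → Fin n → ℝ) => g z.1) 0 := fun {g} hg =>
    ContDiffAt.comp (g := g) (0 : (Fin n → ℝ) × (Fin n → Fin n → ℝ)) hg contDiffAt_fst
  have hU : ContDiffAt ℝ ∞ U 0 := by
    refine contDiffAt_fst.prodMk (contDiffAt_pi.2 fun p => ContDiffAt.sum fun i _ => ?_)
    exact (hent p i).mul (hfst (hd i))
  have hU0 : U 0 = 0 := by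
    ext i
    · rfl
    · simp [U]
  have hβU : ∀ p q, ContDiffAt ℝ ∞ (fun z => β p q (U z)) 0 := fun p q =>
    ContDiffAt.comp (g := β p q) _ (by rw [hU0]; exact hβ p q) hU
  have hF : ContDiffAt ℝ ∞ F 0 := by
    refine contDiffAt_pi.2 fun i => contDiffAt_pi.2 fun j => ?_
    refine ((hent i j).add (ContDiffAt.sum fun p _ => ContDiffAt.sum fun q _ => ?_)).sub
      (hfst (hρ i j))
    exact (hent p i).mul ((hent q j).mul (hβU p q))
  have hF0 : F 0 = 0 := by
    ext i j
    simp [F, hρ0]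
  have hder : HasFDerivAt (fun Y : (Fin n → Fin n → ℝ) => F (0, Y)) (ContinuousLinearMap.id ℝ (Fin n → Fin n → ℝ)) 0 := by
    rw [hasFDerivAt_pi']
    intro i
    rw [hasFDerivAt_pi']
    intro j
    have e1 : ∀ p i, HasFDerivAt (fun Y : (Fin n → Fin n → ℝ) => Y p i) ((ContinuousLinearMap.proj (R := ℝ)
        (φ := fun _ : Fin n => ℝ) i).comp (ContinuousLinearMap.proj (R := ℝ)
        (φ := fun _ : Fin n => Fin n → ℝ) p)) 0 := fun p i =>
      ((ContinuousLinearMap.proj (R := ℝ) (φ := fun _ : Fin n => ℝ) i).comp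
        (ContinuousLinearMap.proj (R := ℝ) (φ := fun _ : Fin n => Fin n → ℝ) p)).hasFDerivAt
    have e2 : ∀ p q, HasFDerivAt (fun Y : (Fin n → Fin n → ℝ) => Y p i * (Y q j * β p q (U (0, Y))))
        (0 : (Fin n → Fin n → ℝ) →L[ℝ] ℝ) 0 := by
      intro p q
      have hs : ContDiffAt ℝ ∞ (fun Y : (Fin n → Fin n → ℝ) => Y q j * β p q (U (0, Y))) 0 :=
        ContDiffAt.comp (g := fun z : (Fin n → ℝ) × (Fin n → Fin n → ℝ) => z.2 q j * β p q (U z)) (0 : (Fin n → Fin n → ℝ))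
          ((hent q j).mul (hβU p q)) (by fun_prop)
      have := (e1 p i).fun_mul (hs.differentiableAt (by simp)).hasFDerivAt
      simpa using this
    have e3 := ((e1 i j).add (HasFDerivAt.fun_sum (u := Finset.univ) fun p _ =>
      HasFDerivAt.fun_sum (u := Finset.univ) fun q _ => e2 p q)).sub_const (ρ i j 0)
    simp only [Finset.sum_const_zero, add_zero] at e3
    exact e3
  have hinr : fderiv ℝ F 0 ∘L .inr ℝ (Fin n → ℝ) (Fin n → Fin n → ℝ) = ContinuousLinearMap.id ℝ (Fin n → Fin n → ℝ) := by
    have h1 : HasFDerivAt F (fderiv ℝ F 0) ((0 : Fin n → ℝ), (0 : (Fin n → Fin n → ℝ))) :=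
      (hF.differentiableAt (by simp)).hasFDerivAt
    have h2 := h1.comp (0 : (Fin n → Fin n → ℝ)) (hasFDerivAt_prodMk_right (0 : Fin n → ℝ) (0 : (Fin n → Fin n → ℝ)))
    exact h2.unique hder
  have hinv : (fderiv ℝ F 0 ∘L .inr ℝ (Fin n → ℝ) (Fin n → Fin n → ℝ)).IsInvertible := by
    rw [hinr]
    exact ⟨ContinuousLinearEquiv.refl ℝ (Fin n → Fin n → ℝ), rfl⟩
  obtain ⟨Y, hY, hY0, hYe⟩ : ∃ Y : (Fin n → ℝ) → (Fin n → Fin n → ℝ), ContDiffAt ℝ ∞ Y 0 ∧ Y 0 = 0 ∧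
      ∀ᶠ x in 𝓝 (0 : Fin n → ℝ), F (x, Y x) = F 0 :=
    ⟨hF.implicitFunction (by simp) hinv, hF.contDiffAt_implicitFunction (by simp) hinv,
      hF.implicitFunction_apply_self (by simp) hinv,
      hF.eventually_apply_implicitFunction (by simp) hinv⟩
  refine ⟨Y, hY, hY0, ?_⟩
  filter_upwards [hYe] with x hx i j
  have := congrFun (congrFun hx i) j
  rw [hF0] at this
  simp only [F, U, Pi.zero_apply, sub_eq_zero, ← mul_assoc] at this
  exact this.symm

namespace GA

noncomputable section

variable {n : ℕ}

theorem tougeron (h : GA n) (r : Fin n → Fin n → GA n) (hr : ∀ i j, r i j ∈ M n ^ 2) :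
    ∃ φ : TMap n, pull φ.f φ.smooth φ.zero h = h + ∑ i, ∑ j, r i j * D i h * D j h := by
  obtain ⟨f, hf, rfl⟩ := exists_rep h
  obtain ⟨β, hβ, hβ1⟩ := hadamard_two hf
  obtain ⟨Y, hY, hY0, hY1⟩ := exists_matrix (fun i p => fderiv ℝ f p (Pi.single i 1)) (smooth_pd hf)
    β hβ (fun i j => rep (r i j)) (fun i j => rep_smooth _) (fun i j => by
      have := Ideal.pow_le_self two_ne_zero (hr i j)
      rwa [mem_M, ev_eq] at this)
  have hYs : ∀ i j, ContDiffAt ℝ ∞ (fun x => Y x i j) 0 := fun i j =>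
    contDiffAt_pi.1 (contDiffAt_pi.1 hY i) j
  have hYM : ∀ i j, mk (fun x => Y x i j) (hYs i j) ∈ M n := fun i j => by
    rw [mem_M, ev_mk, hY0]; rfl
  let u : (Fin n → ℝ) → (Fin n → ℝ) := fun x p => ∑ i, Y x p i * fderiv ℝ f x (Pi.single i 1)
  have hu : ContDiffAt ℝ ∞ u 0 := contDiffAt_pi.2 fun p => ContDiffAt.sum fun i _ =>
    (hYs p i).mul (smooth_pd hf i)
  have hu0 : u 0 = 0 := by ext p; simp [u, hY0]
  have hxu : ContDiffAt ℝ ∞ (fun x => (x, u x)) 0 := contDiffAt_id.prodMk hu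
  have hxu0 : ((0 : Fin n → ℝ), u 0) = 0 := by rw [hu0]; rfl
  have hβs : ∀ p q, ContDiffAt ℝ ∞ (fun x => β p q (x, u x)) 0 := fun p q =>
    ContDiffAt.comp (g := β p q) (0 : Fin n → ℝ) (by rw [hxu0]; exact hβ p q) hxu
  have hYM2 : ∀ i j, mk (fun x => Y x i j) (hYs i j) ∈ M n ^ 2 := fun i j => by
    have e : mk (fun x => Y x i j) (hYs i j) = r i j - ∑ p, ∑ q, mk (fun x => Y x p i) (hYs p i) *
        mk (fun x => Y x q j) (hYs q j) * mk (fun x => β p q (x, u x)) (hβs p q) := by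
      rw [eq_sub_iff_add_eq]
      conv_rhs => rw [← mk_rep (r i j)]
      simp only [mk_mul]
      have s1 : ∀ p q, ContDiffAt ℝ ∞ (fun x => Y x p i * Y x q j * β p q (x, u x)) 0 := fun p q =>
        ((hYs p i).mul (hYs q j)).mul (hβs p q)
      have s2 : ∀ p, ContDiffAt ℝ ∞ (fun x => ∑ q, Y x p i * Y x q j * β p q (x, u x)) 0 :=
        fun p => ContDiffAt.sum fun q _ => s1 p q
      simp only [mk_sum _ _ (s1 _)]
      rw [mk_sum _ _ s2, mk_add, mk_eq]
      filter_upwards [hY1] with x hx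
      exact (hx i j).symm
    rw [e]
    refine sub_mem (hr i j) (Ideal.sum_mem _ fun p _ => Ideal.sum_mem _ fun q _ => ?_)
    rw [pow_two]
    exact Ideal.mul_mem_right _ _ (Ideal.mul_mem_mul (hYM _ _) (hYM _ _))
  have hus : ∀ p, ContDiffAt ℝ ∞ (fun x => u x p) 0 := contDiffAt_pi.1 hu
  have huM : ∀ p, mk (fun x => u x p) (hus p) ∈ M n ^ 2 := fun p => by
    have e : mk (fun x => u x p) (hus p) =
        ∑ i, mk (fun x => Y x p i) (hYs p i) * D i (mk f hf) := by
      simp only [D_mk, mk_mul]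
      rw [mk_sum _ _ fun i => (hYs p i).mul (smooth_pd hf i)]
    rw [e]
    exact Ideal.sum_mem _ fun i _ => Ideal.mul_mem_right _ _ (hYM2 _ _)
  obtain ⟨φ, hφ⟩ := exists_TMap (fun p => X p + mk (fun x => u x p) (hus p)) (fun p => by
    rw [add_sub_cancel_left]; exact huM p)
  refine ⟨φ, ?_⟩
  have hφ' : ∀ᶠ x in 𝓝 0, φ.f x = x + u x := by
    have : ∀ p, ∀ᶠ x in 𝓝 0, φ.f x p = x p + u x p := fun p => by
      have := hφ p
      rw [pull_X, X, mk_add, mk_eq] at this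
      exact this
    filter_upwards [eventually_all.2 this] with x hx
    ext p
    exact hx p
  have e2 : ∑ i, ∑ j, r i j * D i (mk f hf) * D j (mk f hf) = mk (fun x => ∑ i, ∑ j,
      rep (r i j) x * fderiv ℝ f x (Pi.single i 1) * fderiv ℝ f x (Pi.single j 1))
      (ContDiffAt.sum fun i _ => ContDiffAt.sum fun j _ =>
        ((rep_smooth _).mul (smooth_pd hf i)).mul (smooth_pd hf j)) := by
    have s1 : ∀ i j, ContDiffAt ℝ ∞ (fun x => rep (r i j) x * fderiv ℝ f x (Pi.single i 1) *
        fderiv ℝ f x (Pi.single j 1)) 0 := fun i j =>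
      ((rep_smooth _).mul (smooth_pd hf i)).mul (smooth_pd hf j)
    have s3 : ∀ i j, r i j * D i (mk f hf) * D j (mk f hf) = mk _ (s1 i j) := fun i j => by
      conv_lhs => rw [← mk_rep (r i j)]
      rw [D_mk, D_mk, mk_mul, mk_mul]
    simp only [s3, mk_sum _ _ (s1 _)]
    rw [mk_sum _ _ fun i => ContDiffAt.sum fun j _ => s1 i j]
  rw [e2, pull_mk, mk_add, mk_eq]
  have ht : Tendsto (fun x => (x, u x)) (𝓝 0) (𝓝 0) := by
    have := hxu.continuousAt.tendsto
    rwa [hxu0] at this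
  filter_upwards [hφ', hY1, ht.eventually hβ1] with x h1 h2 h3
  rw [h1, h3]
  congr 1
  simp only [h2]
  exact sum_identity (Y x) (fun p q => β p q (x, u x)) (fun i => fderiv ℝ f x (Pi.single i 1))

end

end GA


namespace GA

noncomputable section

variable {n : ℕ}

/-- The Jacobian ideal. -/
def J (h : GA n) : Ideal (GA n) := Ideal.span (Set.range fun i => D i h)

theorem mem_mul_J {I : Ideal (GA n)} {h a : GA n} (ha : a ∈ I * J h) :
    ∃ c : Fin n → GA n, (∀ i, c i ∈ I) ∧ a = ∑ i, c i * D i h := by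
  refine Submodule.mul_induction_on ha ?_ ?_
  · intro r hr s hs
    rw [J, Ideal.mem_span_range_iff_exists_fun] at hs
    obtain ⟨b, rfl⟩ := hs
    refine ⟨fun i => r * b i, fun i => Ideal.mul_mem_right _ _ hr, ?_⟩
    rw [Finset.mul_sum]
    exact Finset.sum_congr rfl fun i _ => by ring
  · rintro x y ⟨c, hc, rfl⟩ ⟨d, hd, rfl⟩
    refine ⟨fun i => c i + d i, fun i => add_mem (hc i) (hd i), ?_⟩
    rw [← Finset.sum_add_distrib]
    exact Finset.sum_congr rfl fun i _ => by ring

theorem nak {k : ℕ} {N : Ideal (GA n)} (hN : M n ^ k ≤ N ⊔ M n ^ (k + 1)) : M n ^ k ≤ N := by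
  refine Submodule.le_of_le_smul_of_le_jacobson_bot (I := M n) (M_fg.pow) M_le_jac ?_
  rw [smul_eq_mul, ← pow_succ']
  exact hN

theorem perturb {k : ℕ} {h S : GA n} (hh : M n ^ k ≤ M n * J h) (hS : S ∈ M n ^ (k + 1)) :
    M n ^ k ≤ M n * J (h + S) := by
  refine nak (hh.trans ?_)
  have h1 : J h ≤ J (h + S) ⊔ M n ^ k := by
    rw [J, Ideal.span_le]
    rintro _ ⟨i, rfl⟩
    have : D i h = D i (h + S) - D i S := by rw [map_add, add_sub_cancel_right]
    show D i h ∈ _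
    rw [this]
    exact sub_mem (Ideal.mem_sup_left (Ideal.subset_span ⟨i, rfl⟩))
      (Ideal.mem_sup_right (derivation_pow _ _ _ hS))
  calc M n * J h ≤ M n * (J (h + S) ⊔ M n ^ k) := Ideal.mul_mono_right h1
    _ = _ := by rw [Ideal.mul_sup, ← pow_succ']

theorem TMap.comp (φ φ₂ : TMap n) : ∃ χ : TMap n, ∀ a, pull χ.f χ.smooth χ.zero a =
    pull φ₂.f φ₂.smooth φ₂.zero (pull φ.f φ.smooth φ.zero a) := by
  have hs : ContDiffAt ℝ ∞ (fun x => φ.f (φ₂.f x)) 0 :=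
    ContDiffAt.comp (g := φ.f) (0 : Fin n → ℝ) (by rw [φ₂.zero]; exact φ.smooth) φ₂.smooth
  have h0 : φ.f (φ₂.f 0) = 0 := by rw [φ₂.zero, φ.zero]
  have key : ∀ a, pull (fun x => φ.f (φ₂.f x)) hs h0 a =
    pull φ₂.f φ₂.smooth φ₂.zero (pull φ.f φ.smooth φ.zero a) := by
    intro a
    obtain ⟨f, hf, rfl⟩ := exists_rep a
    rw [pull_mk, pull_mk, pull_mk]
  refine ⟨⟨fun x => φ.f (φ₂.f x), hs, h0, fun i => ?_⟩, key⟩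
  rw [key]
  have h1 := pull_M_pow φ₂.smooth φ₂.zero 2 (φ.tangent i)
  rw [map_sub] at h1
  simpa using add_mem h1 (φ₂.tangent i)

theorem main_base {k : ℕ} {h R : GA n} (hh : M n ^ k ≤ M n * J h) (hR : R ∈ M n ^ (2 * k + 2)) :
    ∃ φ : TMap n, pull φ.f φ.smooth φ.zero h = h + R := by
  have h1 : M n ^ (k + 1) ≤ M n ^ 2 * J h := by
    rw [pow_succ', pow_two, mul_assoc]
    exact Ideal.mul_mono_right hh
  have h2 : R ∈ (M n ^ 2 * J h) * J h := by
    rw [show 2 * k + 2 = (k + 1) + (k + 1) by ring, pow_add] at hR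
    exact Ideal.mul_mono h1 (h1.trans Ideal.mul_le_right) hR
  obtain ⟨c, hc, rfl⟩ := mem_mul_J h2
  choose r hr hcr using fun i => mem_mul_J (hc i)
  obtain ⟨φ, hφ⟩ := tougeron h (fun i j => r j i) fun i j => hr j i
  refine ⟨φ, ?_⟩
  rw [hφ, Finset.sum_comm]
  congr 1
  refine Finset.sum_congr rfl fun i _ => ?_
  rw [hcr i, Finset.sum_mul]

theorem main_step {k : ℕ} (m : ℕ) : ∀ (j : ℕ), k ≤ j → 2 * k + 2 ≤ j + 1 + m → ∀ {h R : GA n},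
    M n ^ k ≤ M n * J h → R ∈ M n ^ (j + 1) →
    ∃ φ : TMap n, pull φ.f φ.smooth φ.zero h = h + R := by
  induction m with
  | zero =>
    intro j _ hj h R hh hR
    exact main_base hh (Ideal.pow_le_pow_right (by omega) hR)
  | succ m ih =>
    intro j hkj hj h R hh hR
    have h1 : R ∈ M n ^ 2 * J h := by
      have : M n ^ (k + 1) ≤ M n ^ 2 * J h := by
        rw [pow_succ', pow_two, mul_assoc]
        exact Ideal.mul_mono_right hh
      exact this (Ideal.pow_le_pow_right (by omega) hR)
    obtain ⟨c, hc, hRc⟩ := mem_mul_J h1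
    rw [← vf_apply] at hRc
    obtain ⟨φ, hφ⟩ := exp_step j h c hc (hRc ▸ hR)
    rw [← hRc] at hφ
    set R' := pull φ.f φ.smooth φ.zero h - (h + R) with hR'
    have e : pull φ.f φ.smooth φ.zero h = h + (R + R') := by rw [hR']; ring
    have hh1 : M n ^ k ≤ M n * J (pull φ.f φ.smooth φ.zero h) := by
      rw [e]
      exact perturb hh (add_mem (Ideal.pow_le_pow_right (by omega) hR)
        (Ideal.pow_le_pow_right (by omega) hφ))
    obtain ⟨φ₂, hφ₂⟩ := ih (j + 1) (by omega) (by omega) hh1 (neg_mem hφ)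
    obtain ⟨χ, hχ⟩ := φ.comp φ₂
    refine ⟨χ, ?_⟩
    rw [hχ, hφ₂, e]
    ring

theorem TMap.hasFDerivAt (φ : TMap n) :
    HasFDerivAt φ.f (ContinuousLinearMap.id ℝ (Fin n → ℝ)) 0 := by
  rw [hasFDerivAt_pi']
  intro i
  have hi := contDiffAt_pi.1 φ.smooth i
  have hx : ContDiffAt ℝ ∞ (fun x : Fin n → ℝ => x i) 0 := by fun_prop
  have h1 : pull φ.f φ.smooth φ.zero (X i) - X i =
      GA.mk (fun x : Fin n → ℝ => φ.f x i - x i) (hi.sub hx) := by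
    rw [sub_eq_iff_eq_add, pull_X, X, mk_add, mk_eq]
    exact Eventually.of_forall fun x => by simp
  have h2 := φ.tangent i
  rw [h1, ← vanish_iff] at h2
  have h3 := h2 1 (by norm_num)
  have h4 : fderiv ℝ (fun x : Fin n → ℝ => φ.f x i - x i) 0 = 0 := by
    ext v
    have := congrArg (fun T => T (fun _ => v)) h3
    simpa [iteratedFDeriv_one_apply] using this
  have h5 : HasFDerivAt (fun x : Fin n → ℝ => φ.f x i - x i) (0 : (Fin n → ℝ) →L[ℝ] ℝ) 0 := by
    rw [← h4]
    exact ((hi.sub hx).differentiableAt (by simp)).hasFDerivAt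
  have h6 := h5.fun_add (ContinuousLinearMap.proj (R := ℝ) (φ := fun _ : Fin n => ℝ) i).hasFDerivAt
  simpa using h6

end

end GA

theorem TMap_inverse {n : ℕ} (φ : GA.TMap n) : ∃ ψ : (Fin n → ℝ) → (Fin n → ℝ),
    ContDiffAt ℝ ∞ ψ 0 ∧ ψ 0 = 0 ∧ (ψ ∘ φ.f =ᶠ[𝓝 0] id) ∧ (φ.f ∘ ψ =ᶠ[𝓝 0] id) := by
  have hd : HasFDerivAt φ.f ((ContinuousLinearEquiv.refl ℝ (Fin n → ℝ) :
    (Fin n → ℝ) →L[ℝ] (Fin n → ℝ))) 0 := φ.hasFDerivAt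
  have hne : (∞ : WithTop ℕ∞) ≠ 0 := by simp
  have hst := φ.smooth.hasStrictFDerivAt' hd hne
  refine ⟨hst.localInverse, ?_, ?_, ?_, ?_⟩
  · have := φ.smooth.to_localInverse hd hne
    rw [φ.zero] at this
    exact this
  · have := hst.localInverse_apply_image
    rwa [φ.zero] at this
  · exact hst.eventually_left_inverse
  · have := hst.eventually_right_inverse
    rw [φ.zero] at this
    exact this


/-- finite determinacy criterion. Let `h ∈ m_n` be a smooth germ with
`m_n^k ⊆ m_n·J_h + m_n^{k+1}` (every smooth germ `w ∈ m_n^k` can be written as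
`Σᵢ aᵢ·∂h/∂xᵢ + r` with `aᵢ ∈ m_n` and `r ∈ m_n^{k+1}`). Then `h` is `k`-determined:
for every smooth `R ∈ m_n^{k+1}`, `h` and `h + R` are right equivalent. -/
theorem finite_determinacy_criterion
    (n k : ℕ) (h : (Fin n → ℝ) → ℝ) (hs : ContDiffAt ℝ (⊤ : ℕ∞) h 0) (h0 : h 0 = 0)
    (hyp : ∀ w : (Fin n → ℝ) → ℝ, ContDiffAt ℝ (⊤ : ℕ∞) w 0 → VanishToN n k w →
      ∃ (a : Fin n → ((Fin n → ℝ) → ℝ)) (r : (Fin n → ℝ) → ℝ),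
        (∀ i, ContDiffAt ℝ (⊤ : ℕ∞) (a i) 0 ∧ a i 0 = 0) ∧
        ContDiffAt ℝ (⊤ : ℕ∞) r 0 ∧ VanishToN n (k + 1) r ∧
        w =ᶠ[nhds 0] fun p => (∑ i, a i p * fderiv ℝ h p (Pi.single i 1)) + r p) :
    ∀ R : (Fin n → ℝ) → ℝ, ContDiffAt ℝ (⊤ : ℕ∞) R 0 → VanishToN n (k + 1) R →
      RightEquivN n h (fun p => h p + R p) := by
  intro R hR hRv
  have hk : GA.M n ^ k ≤ GA.M n * GA.J (GA.mk h hs) := by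
    refine GA.nak fun w hw => ?_
    obtain ⟨f, hf, rfl⟩ := GA.exists_rep w
    rw [← GA.vanish_iff] at hw
    obtain ⟨a, r, ha, hr, hrv, he⟩ := hyp f hf hw
    have e : GA.mk f hf = ∑ i, GA.mk (a i) (ha i).1 * GA.D i (GA.mk h hs) + GA.mk r hr := by
      have s1 : ∀ i, ContDiffAt ℝ ∞ (fun p => a i p * fderiv ℝ h p (Pi.single i 1)) 0 := fun i =>
        (ha i).1.mul (GA.smooth_pd hs i)
      simp only [GA.D_mk, GA.mk_mul]
      rw [GA.mk_sum _ _ s1, GA.mk_add, GA.mk_eq]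
      exact he
    rw [e]
    refine add_mem (Ideal.mem_sup_left (Ideal.sum_mem _ fun i _ => Ideal.mul_mem_mul ?_
      (Ideal.subset_span ⟨i, rfl⟩))) (Ideal.mem_sup_right ((GA.vanish_iff _ _).1 hrv))
    rw [GA.mem_M, GA.ev_mk]
    exact (ha i).2
  obtain ⟨φ, hφ⟩ := GA.main_step (k := k) (k + 1) k le_rfl (by omega) hk ((GA.vanish_iff _ hR).1 hRv)
  obtain ⟨ψ, hψ, hψ0, h1, h2⟩ := TMap_inverse φ
  rw [GA.pull_mk, GA.mk_add, GA.mk_eq] at hφ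
  exact ⟨φ.f, ψ, φ.smooth, hψ, φ.zero, hψ0, h1, h2, hφ⟩
end

section
/- Let k ≥ 5 be a natural number and let R ∈ m₂^{k+1}. Then m₂^{2k−3} ⊆ m₂·J_{f_k + R} + m₂^{2k−2}, where J_{f_k+R} is the ideal of E₂ generated by the two partial derivatives of f_k + R. -/
open Filter Topology

/-- The function `f_k = Re((x+iy)^k)` on `ℝ²`. -/
noncomputable def fkFun (k : ℕ) : ℝ × ℝ → ℝ :=
  fun p => (((p.1 : ℂ) + p.2 * Complex.I) ^ k).re


/-- Smooth germ all of whose derivatives of order `< m` vanish at `0`. -/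
def GoodGerm {F : Type*} [NormedAddCommGroup F] [NormedSpace ℝ F] (m : ℕ) (f : ℝ × ℝ → F) : Prop :=
  ContDiffAt ℝ (⊤ : ℕ∞) f 0 ∧ ∀ j, j < m → iteratedFDeriv ℝ j f 0 = 0

section
variable {F G : Type*} [NormedAddCommGroup F] [NormedSpace ℝ F]
  [NormedAddCommGroup G] [NormedSpace ℝ G]

theorem cda_nat {f : ℝ × ℝ → F} (h : ContDiffAt ℝ (⊤ : ℕ∞) f 0) (j : ℕ) : ContDiffAt ℝ j f 0 :=
  h.of_le (by exact_mod_cast le_top)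

theorem GoodGerm.add {m : ℕ} {f g : ℝ × ℝ → F} (hf : GoodGerm m f) (hg : GoodGerm m g) :
    GoodGerm m (f + g) := by
  refine ⟨hf.1.add hg.1, fun j hj => ?_⟩
  rw [iteratedFDeriv_add_apply (cda_nat hf.1 j) (cda_nat hg.1 j), hf.2 j hj, hg.2 j hj, add_zero]

theorem GoodGerm.sub {m : ℕ} {f g : ℝ × ℝ → F} (hf : GoodGerm m f) (hg : GoodGerm m g) :
    GoodGerm m (f - g) := by
  refine ⟨hf.1.sub hg.1, fun j hj => ?_⟩
  rw [iteratedFDeriv_sub_apply (cda_nat hf.1 j) (cda_nat hg.1 j), hf.2 j hj, hg.2 j hj, sub_zero]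

theorem GoodGerm.clm {m : ℕ} {f : ℝ × ℝ → F} (L : F →L[ℝ] G) (hf : GoodGerm m f) :
    GoodGerm m (fun p => L (f p)) := by
  refine ⟨L.contDiff.contDiffAt.comp _ hf.1, fun j hj => ?_⟩
  have := L.iteratedFDeriv_comp_left (cda_nat hf.1 j) le_rfl
  rw [hf.2 j hj] at this
  refine this.trans ?_
  ext; simp

theorem GoodGerm.congr {m : ℕ} {f g : ℝ × ℝ → F} (hf : GoodGerm m f) (h : g =ᶠ[𝓝 0] f) :
    GoodGerm m g := by
  refine ⟨hf.1.congr_of_eventuallyEq h, fun j hj => ?_⟩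
  rw [(h.iteratedFDeriv (𝕜 := ℝ) j).eq_of_nhds, hf.2 j hj]

theorem GoodGerm.fderiv {m : ℕ} {f : ℝ × ℝ → F} (hf : GoodGerm (m + 1) f) :
    GoodGerm m (fderiv ℝ f) := by
  refine ⟨hf.1.fderiv_right (by simp), fun j hj => ?_⟩
  rw [← norm_eq_zero, norm_iteratedFDeriv_fderiv, hf.2 (j + 1) (by omega), norm_zero]

theorem GoodGerm.mul {A : Type*} [NormedRing A] [NormedAlgebra ℝ A] {m n : ℕ} {f g : ℝ × ℝ → A}
    (hf : GoodGerm m f) (hg : GoodGerm n g) : GoodGerm (m + n) (fun p => f p * g p) := by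
  refine ⟨hf.1.mul hg.1, fun j hj => ?_⟩
  obtain ⟨u, hu, hfu⟩ := (cda_nat hf.1 j).contDiffOn le_rfl (by simp)
  obtain ⟨v, hv, hgv⟩ := (cda_nat hg.1 j).contDiffOn le_rfl (by simp)
  obtain ⟨s, hs, hso, h0⟩ := mem_nhds_iff.1 (Filter.inter_mem
    (by simpa using hu) (by simpa using hv) : u ∩ v ∈ 𝓝 (0 : ℝ × ℝ))
  have := norm_iteratedFDerivWithin_mul_le (hfu.mono (hs.trans Set.inter_subset_left))
    (hgv.mono (hs.trans Set.inter_subset_right)) hso.uniqueDiffOn h0 (n := j) le_rfl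
  simp only [iteratedFDerivWithin_of_isOpen _ hso h0] at this
  rw [← norm_eq_zero]
  refine le_antisymm (this.trans (le_of_eq (Finset.sum_eq_zero fun i hi => ?_))) (norm_nonneg _)
  by_cases h : i < m
  · simp [hf.2 i h]
  · simp [hg.2 (j - i) (by have := Finset.mem_range.1 hi; omega)]
end

/-- the coordinate `z` -/
noncomputable def zc (p : ℝ × ℝ) : ℂ := (p.1 : ℂ) + p.2 * Complex.I
/-- the coordinate `z` conjugate -/
noncomputable def zb (p : ℝ × ℝ) : ℂ := (p.1 : ℂ) - p.2 * Complex.I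

theorem contDiff_ofReal_fst : ContDiff ℝ (⊤ : ℕ∞) (fun p : ℝ × ℝ => (p.1 : ℂ)) :=
  Complex.ofRealCLM.contDiff.comp contDiff_fst

theorem contDiff_ofReal_snd : ContDiff ℝ (⊤ : ℕ∞) (fun p : ℝ × ℝ => (p.2 : ℂ)) :=
  Complex.ofRealCLM.contDiff.comp contDiff_snd

theorem good_of_zero {f : ℝ × ℝ → ℂ} (h : ContDiff ℝ (⊤ : ℕ∞) f) (h0 : f 0 = 0) :
    GoodGerm 1 f := by
  refine ⟨h.contDiffAt, fun j hj => ?_⟩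
  obtain rfl : j = 0 := by omega
  ext; simp [h0]

theorem good_zc : GoodGerm 1 zc :=
  good_of_zero (contDiff_ofReal_fst.add (contDiff_ofReal_snd.mul contDiff_const)) (by simp [zc])

theorem good_zb : GoodGerm 1 zb :=
  good_of_zero (contDiff_ofReal_fst.sub (contDiff_ofReal_snd.mul contDiff_const)) (by simp [zb])

theorem good_pow {f : ℝ × ℝ → ℂ} (h : GoodGerm 1 f) (n : ℕ) : GoodGerm n (fun p => f p ^ n) := by
  induction n with
  | zero => exact ⟨by simpa using contDiffAt_const, fun j hj => absurd hj (by omega)⟩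
  | succ n ih => simpa only [pow_succ] using ih.mul h

theorem good_mono (a b : ℕ) : GoodGerm (a + b) (fun p => zc p ^ a * zb p ^ b) :=
  (good_pow good_zc a).mul (good_pow good_zb b)

/-- span of monomials in `z`, conj `z` of degree `n` -/
noncomputable def monoSpan (n : ℕ) : Submodule ℂ (ℝ × ℝ → ℂ) :=
  Submodule.span ℂ {g | ∃ a b, a + b = n ∧ g = fun p => zc p ^ a * zb p ^ b}

theorem monoSpan_mul (n : ℕ) (g : ℝ × ℝ → ℂ) (hg : g ∈ monoSpan n) :
    (fun p => (p.1 : ℂ) * g p) ∈ monoSpan (n + 1) ∧ (fun p => (p.2 : ℂ) * g p) ∈ monoSpan (n + 1) := by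
  induction hg using Submodule.span_induction with
  | mem g h =>
    obtain ⟨a, b, hab, rfl⟩ := h
    have h1 : (fun p => zc p ^ (a + 1) * zb p ^ b) ∈ monoSpan (n + 1) :=
      Submodule.subset_span ⟨a + 1, b, by omega, rfl⟩
    have h2 : (fun p => zc p ^ a * zb p ^ (b + 1)) ∈ monoSpan (n + 1) :=
      Submodule.subset_span ⟨a, b + 1, by omega, rfl⟩
    constructor
    · convert Submodule.smul_mem _ (1 / 2 : ℂ) (Submodule.add_mem _ h1 h2) using 1
      ext p
      have : (p.1 : ℂ) = 1 / 2 * (zc p + zb p) := by simp only [zc, zb]; ring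
      simp only [Pi.smul_apply, Pi.add_apply, smul_eq_mul]
      rw [this]; ring
    · convert Submodule.smul_mem _ (-Complex.I / 2 : ℂ) (Submodule.sub_mem _ h1 h2) using 1
      ext p
      have : (p.2 : ℂ) = -Complex.I / 2 * (zc p - zb p) := by
        simp only [zc, zb]; linear_combination (p.2 : ℂ) * Complex.I_sq
      simp only [Pi.smul_apply, Pi.sub_apply, smul_eq_mul]
      rw [this]; ring
  | zero => 
    constructor <;> convert Submodule.zero_mem _ using 1 <;> ext <;> simp
  | add x y _ _ hx hy =>
    constructor
    · convert Submodule.add_mem _ hx.1 hy.1 using 1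
      ext p; simp [mul_add]
    · convert Submodule.add_mem _ hx.2 hy.2 using 1
      ext p; simp [mul_add]
  | smul c x _ hx =>
    constructor
    · convert Submodule.smul_mem _ c hx.1 using 1
      ext p; simp; ring
    · convert Submodule.smul_mem _ c hx.2 using 1
      ext p; simp; ring

theorem diag_mem (n : ℕ) (M : ContinuousMultilinearMap ℝ (fun _ : Fin n => ℝ × ℝ) ℝ) :
    (fun p => ((M fun _ => p : ℝ) : ℂ)) ∈ monoSpan n := by
  induction n with
  | zero =>
    convert Submodule.smul_mem (monoSpan 0) ((M fun _ => 0 : ℝ) : ℂ)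
      (Submodule.subset_span ⟨0, 0, rfl, rfl⟩ : (fun p => zc p ^ 0 * zb p ^ 0) ∈ monoSpan 0) using 1
    funext p
    have : (fun _ => p : Fin 0 → ℝ × ℝ) = fun _ => 0 := funext fun i => i.elim0
    rw [this]
    simp
  | succ n ih =>
    convert Submodule.add_mem _ (monoSpan_mul n _ (ih (M.curryLeft (1, 0)))).1
      (monoSpan_mul n _ (ih (M.curryLeft (0, 1)))).2 using 1
    ext p
    simp only [Pi.add_apply]
    norm_cast
    have h1 : (M fun _ => p) = M.curryLeft p (fun _ => p) := by
      rw [ContinuousMultilinearMap.curryLeft_apply]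
      congr 1
      ext i : 1
      refine Fin.cases ?_ (fun i => ?_) i <;> simp
    have h2 : p = p.1 • ((1, 0) : ℝ × ℝ) + p.2 • ((0, 1) : ℝ × ℝ) := by ext <;> simp
    have h3 : M.curryLeft p = p.1 • M.curryLeft (1, 0) + p.2 • M.curryLeft (0, 1) := by
      conv_lhs => rw [h2]
      rw [map_add, map_smul, map_smul]
    rw [h1, h3]
    simp

theorem decomp (k : ℕ) (hk : 5 ≤ k) (g : ℝ × ℝ → ℂ) (hg : g ∈ monoSpan (2 * k - 3)) :
    GoodGerm (2 * k - 3) g ∧ ∃ A B : ℝ × ℝ → ℂ, GoodGerm (k - 2) A ∧ GoodGerm (k - 2) B ∧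
      ∀ p, g p = A p * zc p ^ (k - 1) + B p * zb p ^ (k - 1) := by
  have good0 : ∀ m, GoodGerm m (0 : ℝ × ℝ → ℂ) := fun m =>
    ⟨contDiffAt_const, fun j _ => by simp⟩
  have hsm : ∀ m (c : ℂ) (f : ℝ × ℝ → ℂ), GoodGerm m f → GoodGerm m (c • f) := fun m c f hf =>
    hf.clm (c • ContinuousLinearMap.id ℝ ℂ)
  induction hg using Submodule.span_induction with
  | mem g h =>
    obtain ⟨a, b, hab, rfl⟩ := h
    refine ⟨hab ▸ good_mono a b, ?_⟩
    by_cases ha : k - 1 ≤ a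
    · obtain ⟨c, rfl⟩ := Nat.exists_eq_add_of_le ha
      refine ⟨fun p => zc p ^ c * zb p ^ b, 0, ?_, good0 _, fun p => ?_⟩
      · have := good_mono c b
        rwa [show c + b = k - 2 by omega] at this
      · simp; ring
    · obtain ⟨c, rfl⟩ := Nat.exists_eq_add_of_le (show k - 1 ≤ b by omega)
      refine ⟨0, fun p => zc p ^ a * zb p ^ c, good0 _, ?_, fun p => ?_⟩
      · have := good_mono a c
        rwa [show a + c = k - 2 by omega] at this
      · simp; ring
  | zero => exact ⟨good0 _, 0, 0, good0 _, good0 _, by simp⟩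
  | add x y _ _ hx hy =>
    obtain ⟨h1, A, B, hA, hB, h⟩ := hx
    obtain ⟨h1', A', B', hA', hB', h'⟩ := hy
    refine ⟨h1.add h1', A + A', B + B', hA.add hA', hB.add hB', fun p => ?_⟩
    simp only [Pi.add_apply, h, h']; ring
  | smul c x _ hx =>
    obtain ⟨h1, A, B, hA, hB, h⟩ := hx
    refine ⟨hsm _ _ _ h1, c • A, c • B, hsm _ _ _ hA, hsm _ _ _ hB, fun p => ?_⟩
    simp only [Pi.smul_apply, smul_eq_mul, h]; ring

theorem zb_conj (p : ℝ × ℝ) : zb p = (starRingEnd ℂ) (zc p) := by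
  simp [zb, zc, sub_eq_add_neg]

theorem decomp_real (k : ℕ) (hk : 5 ≤ k)
    (M : ContinuousMultilinearMap ℝ (fun _ : Fin (2 * k - 3) => ℝ × ℝ) ℝ) :
    GoodGerm (2 * k - 3) (fun p => M fun _ => p) ∧ ∃ A B : ℝ × ℝ → ℝ,
      GoodGerm (k - 2) A ∧ GoodGerm (k - 2) B ∧
      ∀ p, (M fun _ => p) = A p * (zc p ^ (k - 1)).re + B p * (zc p ^ (k - 1)).im := by
  obtain ⟨h1, A, B, hA, hB, h⟩ := decomp k hk _ (diag_mem _ M)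
  refine ⟨by simpa using h1.clm Complex.reCLM, fun p => (A p).re + (B p).re,
    fun p => (B p).im - (A p).im, (hA.clm Complex.reCLM).add (hB.clm Complex.reCLM),
    (hB.clm Complex.imCLM).sub (hA.clm Complex.imCLM), fun p => ?_⟩
  have := congrArg Complex.re (h p)
  rw [zb_conj, ← map_pow] at this
  simp only [Complex.ofReal_re, Complex.add_re, Complex.mul_re, Complex.conj_re, Complex.conj_im]
    at this
  rw [this]; ring

theorem hasFDerivAt_zc (p : ℝ × ℝ) : HasFDerivAt zc
    (Complex.ofRealCLM.comp (ContinuousLinearMap.fst ℝ ℝ ℝ) +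
      (Complex.I • Complex.ofRealCLM.comp (ContinuousLinearMap.snd ℝ ℝ ℝ))) p := by
  convert ContinuousLinearMap.hasFDerivAt (x := p) (Complex.ofRealCLM.comp (ContinuousLinearMap.fst ℝ ℝ ℝ) +
      (Complex.I • Complex.ofRealCLM.comp (ContinuousLinearMap.snd ℝ ℝ ℝ))) using 1
  ext p
  simp [zc, mul_comm]

theorem fk_deriv (k : ℕ) (p : ℝ × ℝ) : DifferentiableAt ℝ (fkFun k) p ∧
    fderiv ℝ (fkFun k) p (1, 0) = k * (zc p ^ (k - 1)).re ∧
    fderiv ℝ (fkFun k) p (0, 1) = - (k * (zc p ^ (k - 1)).im) := by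
  have h := Complex.reCLM.hasFDerivAt.comp p ((hasFDerivAt_zc p).pow k)
  change HasFDerivAt (fkFun k) _ p at h
  refine ⟨h.differentiableAt, ?_, ?_⟩ <;> rw [h.fderiv] <;> simp

theorem symm_adj {E : Type} [NormedAddCommGroup E] [NormedSpace ℝ E] (n : ℕ) :
    ∀ {F : Type} [NormedAddCommGroup F] [NormedSpace ℝ F]
    (f : E → F) (x : E) (_ : ContDiffAt ℝ (⊤ : ℕ∞) f x) (i : Fin n) (v : Fin (n + 1) → E),
    iteratedFDeriv ℝ (n + 1) f x (v ∘ Equiv.swap i.castSucc i.succ) =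
      iteratedFDeriv ℝ (n + 1) f x v := by
  induction n with
  | zero => intro F _ _ f x h i; exact i.elim0
  | succ n ih =>
    intro F _ _ f x h i v
    have h1 : ContDiffAt ℝ (⊤ : ℕ∞) (fderiv ℝ f) x := h.fderiv_right (by simp)
    refine Fin.lastCases ?_ (fun i => ?_) i
    · have h2 : ContDiffAt ℝ (⊤ : ℕ∞) (fderiv ℝ (fderiv ℝ f)) x := h1.fderiv_right (by simp)
      have key : ∀ (u : Fin n → E) (a b : E),
          iteratedFDeriv ℝ n (fderiv ℝ (fderiv ℝ f)) x u a b =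
          iteratedFDeriv ℝ n (fderiv ℝ (fderiv ℝ f)) x u b a := by
        intro u a b
        let L : (E →L[ℝ] E →L[ℝ] F) →L[ℝ] (E →L[ℝ] E →L[ℝ] F) :=
          (ContinuousLinearMap.flipₗᵢ ℝ E E F).toContinuousLinearEquiv.toContinuousLinearMap
        have hev : fderiv ℝ (fderiv ℝ f) =ᶠ[𝓝 x]
            L ∘
              fderiv ℝ (fderiv ℝ f) := by
          have hh : ContDiffAt ℝ 2 f x :=
            h.of_le (WithTop.coe_le_coe.2 (le_top : (2 : ℕ∞) ≤ ⊤))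
          filter_upwards [hh.eventually (by simp)] with y hy
          have := hy.isSymmSndFDerivAt (by simp)
          ext a b
          exact this a b
        have hc := ContinuousLinearMap.iteratedFDeriv_comp_left (G := E →L[ℝ] E →L[ℝ] F)
          L h2
          (i := n) (by exact_mod_cast le_top)
        conv_lhs => rw [(hev.iteratedFDeriv (𝕜 := ℝ) n).eq_of_nhds, hc]
        rfl
      simp only [iteratedFDeriv_succ_apply_right]
      rw [key]
      have e1 : Fin.init (Fin.init (v ∘ Equiv.swap (Fin.last n).castSucc (Fin.last n).succ)) =
          Fin.init (Fin.init v) := by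
        funext j
        simp only [Fin.init, Function.comp]
        rw [Equiv.swap_apply_of_ne_of_ne] <;> simp [Fin.ext_iff] <;> omega
      rw [e1]
      simp [Fin.init]
    · rw [iteratedFDeriv_succ_apply_right, iteratedFDeriv_succ_apply_right (m := v)]
      have e1 : Fin.init (v ∘ Equiv.swap i.castSucc.castSucc i.castSucc.succ) =
          Fin.init v ∘ Equiv.swap i.castSucc i.succ := by
        funext j
        simp only [Fin.init, Function.comp, Equiv.swap_apply_def]
        congr 1
        split_ifs <;> simp_all [Fin.ext_iff]
      have e2 : (v ∘ Equiv.swap i.castSucc.castSucc i.castSucc.succ) (Fin.last (n + 1)) =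
          v (Fin.last (n + 1)) := by
        simp only [Function.comp]
        rw [Equiv.swap_apply_of_ne_of_ne] <;> simp [Fin.ext_iff] <;> omega
      rw [e1, e2]
      exact congrArg (fun T => T (v (Fin.last (n + 1)))) (ih _ _ h1 i (Fin.init v))

theorem symm_perm {E F : Type} [NormedAddCommGroup E] [NormedSpace ℝ E]
    [NormedAddCommGroup F] [NormedSpace ℝ F] (n : ℕ)
    (f : E → F) (x : E) (h : ContDiffAt ℝ (⊤ : ℕ∞) f x) (σ : Equiv.Perm (Fin n)) (v : Fin n → E) :
    iteratedFDeriv ℝ n f x (fun i => v (σ i)) = iteratedFDeriv ℝ n f x v := by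
  cases n with
  | zero => congr 1; ext i; exact i.elim0
  | succ n =>
    have hσ : σ ∈ Submonoid.closure
        (Set.range fun i : Fin n => Equiv.swap i.castSucc i.succ) := by
      rw [Equiv.Perm.mclosure_swap_castSucc_succ]; trivial
    induction hσ using Submonoid.closure_induction generalizing v with
    | mem σ hs => obtain ⟨i, rfl⟩ := hs; exact symm_adj n f x h i v
    | one => rfl
    | mul a b _ _ ha hb => exact (hb (fun i => v (a i))).trans (ha v)

theorem taylor_part (n : ℕ) (w : ℝ × ℝ → ℝ) (hw : GoodGerm n w)
    (M : ContinuousMultilinearMap ℝ (fun _ : Fin n => ℝ × ℝ) ℝ)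
    (hM : M = ((n.factorial : ℝ)⁻¹) • iteratedFDeriv ℝ n w 0)
    (hP : GoodGerm n (fun p => M fun _ => p)) :
    GoodGerm (n + 1) (w - fun p => M fun _ => p) := by
  have h := hw.sub hP
  refine ⟨h.1, fun j hj => ?_⟩
  rcases Nat.lt_succ_iff_lt_or_eq.1 hj with hj | rfl
  · exact h.2 j hj
  rw [iteratedFDeriv_sub_apply (cda_nat hw.1 j) (cda_nat hP.1 j), sub_eq_zero]
  ext v
  rw [ContinuousMultilinearMap.iteratedFDeriv_comp_diagonal, hM]
  simp only [smul_apply, symm_perm _ _ _ hw.1, Finset.sum_const,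
    Finset.card_univ, Fintype.card_perm, Fintype.card_fin, nsmul_eq_mul, smul_eq_mul]
  rw [mul_inv_cancel_left₀ (by positivity)]

/-- For `k ≥ 5` and a smooth germ `R ∈ m₂^{k+1}`, one has
`m₂^{2k−3} ⊆ m₂·J_{f_k+R} + m₂^{2k−2}`: every smooth germ `w ∈ m₂^{2k−3}` can be written as
`a·∂(f_k+R)/∂x + b·∂(f_k+R)/∂y + r` with `a, b ∈ m₂` and `r ∈ m₂^{2k−2}`. -/
theorem jacobian_ideal_estimate
    (k : ℕ) (hk : 5 ≤ k)
    (R : ℝ × ℝ → ℝ) (hRs : ContDiffAt ℝ (⊤ : ℕ∞) R 0) (hRm : VanishTo (k + 1) R)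
    (w : ℝ × ℝ → ℝ) (hws : ContDiffAt ℝ (⊤ : ℕ∞) w 0) (hwm : VanishTo (2 * k - 3) w) :
    ∃ a b r : ℝ × ℝ → ℝ,
      ContDiffAt ℝ (⊤ : ℕ∞) a 0 ∧ a 0 = 0 ∧
      ContDiffAt ℝ (⊤ : ℕ∞) b 0 ∧ b 0 = 0 ∧
      ContDiffAt ℝ (⊤ : ℕ∞) r 0 ∧ VanishTo (2 * k - 2) r ∧
      w =ᶠ[nhds 0] fun p =>
        a p * fderiv ℝ (fun q => fkFun k q + R q) p (1, 0) +
        b p * fderiv ℝ (fun q => fkFun k q + R q) p (0, 1) + r p := by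
  have hw : GoodGerm (2 * k - 3) w := ⟨hws, hwm⟩
  have hR : GoodGerm (k + 1) R := ⟨hRs, hRm⟩
  obtain ⟨hP, A, B, hA, hB, hAB⟩ := decomp_real k hk
    ((((2 * k - 3).factorial : ℝ)⁻¹) • iteratedFDeriv ℝ (2 * k - 3) w 0)
  have hT := taylor_part _ w hw _ rfl hP
  rw [show 2 * k - 3 + 1 = 2 * k - 2 by omega] at hT
  have hRx : GoodGerm k (fun p => fderiv ℝ R p (1, 0)) :=
    hR.fderiv.clm (ContinuousLinearMap.apply ℝ ℝ ((1, 0) : ℝ × ℝ))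
  have hRy : GoodGerm k (fun p => fderiv ℝ R p (0, 1)) :=
    hR.fderiv.clm (ContinuousLinearMap.apply ℝ ℝ ((0, 1) : ℝ × ℝ))
  have hk0 : (k : ℝ) ≠ 0 := by positivity
  have ha : GoodGerm (k - 2) (fun p => (k : ℝ)⁻¹ * A p) :=
    hA.clm ((k : ℝ)⁻¹ • ContinuousLinearMap.id ℝ ℝ)
  have hb : GoodGerm (k - 2) (fun p => (-(k : ℝ)⁻¹) * B p) :=
    hB.clm ((-(k : ℝ)⁻¹) • ContinuousLinearMap.id ℝ ℝ)
  have hz : ∀ f : ℝ × ℝ → ℝ, GoodGerm (k - 2) f → f 0 = 0 := fun f hf => by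
    have := congrArg (fun M => M 0) (hf.2 0 (by omega))
    simpa using this
  have h1 := ha.mul hRx
  have h2 := hb.mul hRy
  rw [show k - 2 + k = 2 * k - 2 by omega] at h1 h2
  have hr : GoodGerm (2 * k - 2) (fun p => w p -
      ((k : ℝ)⁻¹ * A p * fderiv ℝ (fun q => fkFun k q + R q) p (1, 0) +
        (-(k : ℝ)⁻¹) * B p * fderiv ℝ (fun q => fkFun k q + R q) p (0, 1))) := by
    refine ((hT.sub h1).sub h2).congr ?_
    have hev : ∀ᶠ p in 𝓝 (0 : ℝ × ℝ), ContDiffAt ℝ 1 R p :=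
      (hRs.of_le (by exact_mod_cast le_top)).eventually (by simp)
    filter_upwards [hev] with p hp
    obtain ⟨d, dx, dy⟩ := fk_deriv k p
    rw [fderiv_fun_add d (hp.differentiableAt (by simp))]
    simp only [add_apply, Pi.sub_apply, dx, dy, hAB]
    field_simp
    ring
  refine ⟨_, _, _, ha.1, hz _ ha, hb.1, hz _ hb, hr.1, hr.2, ?_⟩
  filter_upwards with p
  ring
end

section
/- Let k be a natural number with 1 ≤ k ≤ 4 and let h_k be a nonzero homogeneous harmonic polynomial of degree k in the real variables x, y. Then h_k is k-determined: for every germ R ∈ m₂^{k+1}, the germs h_k and h_k + R are right equivalent. -/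
open MvPolynomial Filter Topology

open scoped ContDiff

lemma contDiff_par (n : ℕ) : ∀ {F : Type} [NormedAddCommGroup F] [NormedSpace ℝ F]
    (p : ℕ) (f : ℝ × ℝ → F), ContDiff ℝ n f →
    ContDiff ℝ n (fun x => ∫ t in (0:ℝ)..1, t ^ p • f (t • x)) := by
  induction n with
  | zero =>
    intro F _ _ p f hf
    have hf' := hf.continuous
    apply contDiff_zero.2
    apply intervalIntegral.continuous_parametric_intervalIntegral_of_continuous'
    unfold Function.uncurry
    fun_prop
  | succ n ih =>
    intro F _ _ p f hf
    have hc := hf.continuous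
    have hd : Differentiable ℝ f := hf.differentiable (by simp)
    have hf' : ContDiff ℝ n (fderiv ℝ f) := hf.fderiv_right (by norm_cast)
    have hc' := hf'.continuous
    rw [show ((n + 1 : ℕ) : WithTop ℕ∞) = (n : WithTop ℕ∞) + 1 by norm_cast,
      contDiff_succ_iff_hasFDerivAt]
    refine ⟨_, ih (p + 1) (fderiv ℝ f) hf', fun x => ?_⟩
    obtain ⟨M, hM⟩ := (isCompact_closedBall (0 : ℝ × ℝ) (‖x‖ + 1)).exists_bound_of_continuousOn
      hc'.continuousOn
    refine intervalIntegral.hasFDerivAt_integral_of_dominated_of_fderiv_le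
      (F := fun x t => t ^ p • f (t • x)) (F' := fun x t => t ^ (p + 1) • fderiv ℝ f (t • x))
      (s := Metric.ball x 1) (bound := fun _ => M) (Metric.ball_mem_nhds x one_pos) ?_ ?_ ?_ ?_ ?_ ?_
    · exact Eventually.of_forall fun y =>
        (by fun_prop : Continuous fun t : ℝ => t ^ p • f (t • y)).aestronglyMeasurable
    · exact (by fun_prop : Continuous fun t : ℝ => t ^ p • f (t • x)).intervalIntegrable _ _
    · exact (by fun_prop : Continuous fun t : ℝ => t ^ (p+1) • fderiv ℝ f (t • x)).aestronglyMeasurable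
    · refine Eventually.of_forall fun t ht y hy => ?_
      rw [Set.uIoc_of_le zero_le_one] at ht
      have h1 : ‖y‖ ≤ ‖x‖ + 1 := by
        have := norm_sub_norm_le y x
        rw [mem_ball_iff_norm] at hy
        linarith
      have h2 := hM (t • y) (by
        rw [mem_closedBall_zero_iff, norm_smul, Real.norm_of_nonneg ht.1.le]
        nlinarith [norm_nonneg y, ht.2])
      rw [norm_smul, norm_pow, Real.norm_of_nonneg ht.1.le]
      have h3 : t ^ (p + 1) ≤ 1 := pow_le_one₀ ht.1.le ht.2
      nlinarith [norm_nonneg (fderiv ℝ f (t • y)), pow_nonneg ht.1.le (p+1)]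
    · exact continuous_const.intervalIntegrable _ _
    · refine Eventually.of_forall fun t ht y hy => ?_
      have := ((hd (t • y)).hasFDerivAt.comp y ((hasFDerivAt_id y).const_smul t)).const_smul (t ^ p)
      refine this.congr_fderiv ?_
      ext <;> simp [pow_succ, mul_smul]

lemma contDiffAt_par {F : Type} [NormedAddCommGroup F] [NormedSpace ℝ F]
    (p : ℕ) (f : ℝ × ℝ → F) (hf : ContDiffAt ℝ ∞ f 0) :
    ContDiffAt ℝ ∞ (fun x => ∫ t in (0:ℝ)..1, t ^ p • f (t • x)) 0 := by
  rw [contDiffAt_infty] at hf ⊢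
  intro n
  obtain ⟨u, hu, hfu⟩ := (hf n).contDiffOn le_rfl (by simp)
  obtain ⟨ε, hε, hsub⟩ := Metric.mem_nhds_iff.1 (by simpa using hu : u ∈ 𝓝 (0 : ℝ × ℝ))
  let b : ContDiffBump (0 : ℝ × ℝ) := ⟨ε / 4, ε / 2, by positivity, by linarith⟩
  have hg : ContDiff ℝ n (fun x => b x • f x) := by
    rw [contDiff_iff_contDiffAt]
    intro x
    by_cases hx : x ∈ Metric.ball (0 : ℝ × ℝ) ε
    · exact b.contDiff.contDiffAt.smul ((hfu.mono hsub).contDiffAt (Metric.isOpen_ball.mem_nhds hx))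
    · have : (fun x => b x • f x) =ᶠ[𝓝 x] fun _ => 0 := by
        have : x ∉ tsupport b := by
          rw [b.tsupport_eq]
          intro h
          apply hx
          simp only [b, Metric.mem_closedBall, Metric.mem_ball] at h ⊢
          linarith
        have h2 := (isClosed_tsupport b).isOpen_compl.mem_nhds this
        filter_upwards [h2] with y hy
        rw [image_eq_zero_of_notMem_tsupport hy, zero_smul]
      exact contDiffAt_const.congr_of_eventuallyEq this
  refine (contDiff_par n p _ hg).contDiffAt.congr_of_eventuallyEq ?_
  filter_upwards [Metric.ball_mem_nhds (0 : ℝ × ℝ) (by positivity : 0 < ε / 4)] with x hx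
  refine intervalIntegral.integral_congr fun t ht => ?_
  rw [Set.uIcc_of_le zero_le_one] at ht
  have : b (t • x) = 1 := by
    apply b.one_of_mem_closedBall
    rw [mem_ball_zero_iff] at hx
    rw [mem_closedBall_zero_iff, norm_smul, Real.norm_of_nonneg ht.1]
    simp only [b]
    nlinarith [ht.2, norm_nonneg x]
  simp only [this, one_smul]

lemma vanish_partial (k : ℕ) (f : ℝ × ℝ → ℝ) (hf : ContDiffAt ℝ ∞ f 0) (hv : VanishTo (k + 1) f)
    (v : ℝ × ℝ) : VanishTo k (fun x => fderiv ℝ f x v) := by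
  intro j hj
  have h0 : iteratedFDeriv ℝ j (fderiv ℝ f) 0 = 0 := by
    rw [← norm_eq_zero, norm_iteratedFDeriv_fderiv, hv (j + 1) (by omega), norm_zero]
  have hfd : ContDiffAt ℝ ∞ (fderiv ℝ f) 0 := hf.fderiv_right (by simp)
  have := (ContinuousLinearMap.apply ℝ ℝ v).iteratedFDeriv_comp_left hfd (i := j)
    (by exact_mod_cast le_top)
  rw [h0] at this
  have e : (⇑(ContinuousLinearMap.apply ℝ ℝ v) ∘ fderiv ℝ f) = fun x => fderiv ℝ f x v := by
    ext x; simp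
  rw [e] at this
  rw [this]
  ext; simp

lemma hadamard_s15 (m : ℕ) : ∀ (f : ℝ × ℝ → ℝ), ContDiffAt ℝ ∞ f 0 → VanishTo m f →
    ∃ c : ℕ → ℝ × ℝ → ℝ, (∀ i, ContDiffAt ℝ ∞ (c i) 0) ∧
      f =ᶠ[𝓝 0] fun q => ∑ i ∈ Finset.range (m + 1), q.1 ^ i * q.2 ^ (m - i) * c i q := by
  induction m with
  | zero =>
    intro f hf _
    exact ⟨fun _ => f, fun _ => hf, by simp⟩
  | succ m ih =>
    intro f hf hv
    have hfd : ContDiffAt ℝ ∞ (fderiv ℝ f) 0 := hf.fderiv_right (by simp)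
    have hpd (v : ℝ × ℝ) : ContDiffAt ℝ ∞ (fun x => fderiv ℝ f x v) 0 := by fun_prop
    -- each integrated partial
    have key (v : ℝ × ℝ) : ∃ c : ℕ → ℝ × ℝ → ℝ, (∀ i, ContDiffAt ℝ ∞ (c i) 0) ∧
      (fun x => ∫ t in (0:ℝ)..1, fderiv ℝ f (t • x) v) =ᶠ[𝓝 0]
        fun q => ∑ i ∈ Finset.range (m + 1), q.1 ^ i * q.2 ^ (m - i) * c i q := by
      obtain ⟨c, hc, he⟩ := ih _ (hpd v) (vanish_partial m f hf hv v)
      refine ⟨fun i x => ∫ t in (0:ℝ)..1, t ^ m • c i (t • x),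
        fun i => contDiffAt_par m _ (hc i), ?_⟩
      have hcc : ∀ᶠ x in 𝓝 (0 : ℝ × ℝ), ∀ i ∈ Finset.range (m + 1), ContinuousAt (c i) x := by
        rw [Filter.eventually_all_finset]
        intro i _
        exact (((hc i).of_le (by simp : (1 : WithTop ℕ∞) ≤ ∞)).eventually (by simp)).mono fun x hx => hx.continuousAt
      obtain ⟨ε, hε, hball⟩ := Metric.eventually_nhds_iff_ball.1 (he.and hcc)
      filter_upwards [Metric.ball_mem_nhds (0 : ℝ × ℝ) hε] with x hx
      have hmem (t : ℝ) (ht : t ∈ Set.uIcc (0:ℝ) 1) : t • x ∈ Metric.ball (0 : ℝ × ℝ) ε := by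
        rw [Set.uIcc_of_le zero_le_one] at ht
        rw [mem_ball_zero_iff] at hx ⊢
        rw [norm_smul, Real.norm_of_nonneg ht.1]
        nlinarith [ht.2, norm_nonneg x]
      have h1 : ∫ t in (0:ℝ)..1, fderiv ℝ f (t • x) v =
          ∫ t in (0:ℝ)..1, ∑ i ∈ Finset.range (m + 1),
            x.1 ^ i * x.2 ^ (m - i) * (t ^ m • c i (t • x)) := by
        refine intervalIntegral.integral_congr fun t ht => ?_
        have := (hball _ (hmem t ht)).1
        simp only at this ⊢
        rw [this]
        refine Finset.sum_congr rfl fun i hi => ?_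
        have hi' : i ≤ m := by simpa [Nat.lt_succ_iff] using hi
        have : t ^ m = t ^ i * t ^ (m - i) := by rw [← pow_add]; congr 1; omega
        rw [this]
        simp only [Prod.smul_fst, Prod.smul_snd, smul_eq_mul, mul_pow]
        ring
      rw [h1, intervalIntegral.integral_finsetSum]
      · refine Finset.sum_congr rfl fun i hi => ?_
        rw [intervalIntegral.integral_const_mul]
      · intro i hi
        apply ContinuousOn.intervalIntegrable
        intro t ht
        have h2 := (hball _ (hmem t ht)).2 i hi
        have h3 : ContinuousAt (fun t : ℝ => c i (t • x)) t :=
          ContinuousAt.comp (f := fun t : ℝ => t • x) h2 (by fun_prop)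
        apply ContinuousAt.continuousWithinAt
        fun_prop
    obtain ⟨a, ha, hae⟩ := key (1, 0)
    obtain ⟨b, hb, hbe⟩ := key (0, 1)
    have hf0 : f 0 = 0 := by
      have := hv 0 (by omega)
      have h2 := iteratedFDeriv_zero_apply (𝕜 := ℝ) (f := f) (x := 0) 0
      rw [this] at h2
      simpa using h2.symm
    have hfe : f =ᶠ[𝓝 0] fun x => x.1 * (∫ t in (0:ℝ)..1, fderiv ℝ f (t • x) (1, 0)) +
        x.2 * (∫ t in (0:ℝ)..1, fderiv ℝ f (t • x) (0, 1)) := by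
      have h1 : ∀ᶠ x in 𝓝 (0 : ℝ × ℝ), ContDiffAt ℝ 1 f x :=
        (hf.of_le (by simp : (1 : WithTop ℕ∞) ≤ ∞)).eventually (by simp)
      obtain ⟨ε, hε, hball⟩ := Metric.eventually_nhds_iff_ball.1 h1
      filter_upwards [Metric.ball_mem_nhds (0 : ℝ × ℝ) hε] with x hx
      have hmem (t : ℝ) (ht : t ∈ Set.uIcc (0:ℝ) 1) : t • x ∈ Metric.ball (0 : ℝ × ℝ) ε := by
        rw [Set.uIcc_of_le zero_le_one] at ht
        rw [mem_ball_zero_iff] at hx ⊢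
        rw [norm_smul, Real.norm_of_nonneg ht.1]
        nlinarith [ht.2, norm_nonneg x]
      have hcont (v : ℝ × ℝ) : ContinuousOn (fun t : ℝ => fderiv ℝ f (t • x) v) (Set.uIcc 0 1) := by
        intro t ht
        have h2 : ContinuousAt (fderiv ℝ f) (t • x) :=
          ((hball _ (hmem t ht)).fderiv_right (m := 0) (by simp)).continuousAt
        have h3 : ContinuousAt (fun t : ℝ => fderiv ℝ f (t • x)) t :=
          ContinuousAt.comp (f := fun t : ℝ => t • x) h2 (by fun_prop)
        apply ContinuousAt.continuousWithinAt
        fun_prop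
      have hlin (t : ℝ) : fderiv ℝ f (t • x) x =
          x.1 * fderiv ℝ f (t • x) (1, 0) + x.2 * fderiv ℝ f (t • x) (0, 1) := by
        have : ∀ L : ℝ × ℝ →L[ℝ] ℝ, L x = x.1 * L (1, 0) + x.2 * L (0, 1) := by
          intro L
          have hx : x = x.1 • ((1, 0) : ℝ × ℝ) + x.2 • ((0, 1) : ℝ × ℝ) := by ext <;> simp
          have h := congrArg L hx
          rwa [map_add, map_smul, map_smul, smul_eq_mul, smul_eq_mul] at h
        exact this _
      have hftc := intervalIntegral.integral_eq_sub_of_hasDerivAt (a := 0) (b := 1)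
        (f := fun t : ℝ => f (t • x)) (f' := fun t => fderiv ℝ f (t • x) x)
        (fun t ht => by
          have h2 := ((hball _ (hmem t ht)).differentiableAt (by simp)).hasFDerivAt
          have h3 : HasDerivAt (fun t : ℝ => t • x) x t := by
            simpa using (hasDerivAt_id t).smul_const x
          exact h2.comp_hasDerivAt t h3)
        (hcont x).intervalIntegrable
      simp only [one_smul, zero_smul, hf0, sub_zero] at hftc
      rw [← hftc, intervalIntegral.integral_congr (g := fun t =>
        x.1 * fderiv ℝ f (t • x) (1, 0) + x.2 * fderiv ℝ f (t • x) (0, 1)) (fun t _ => hlin t),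
        intervalIntegral.integral_add, intervalIntegral.integral_const_mul,
        intervalIntegral.integral_const_mul]
      · exact ((hcont (1, 0)).intervalIntegrable).const_mul _
      · exact ((hcont (0, 1)).intervalIntegrable).const_mul _
    refine ⟨fun i q => (if i = 0 then 0 else a (i - 1) q) + (if i = m + 1 then 0 else b i q),
      fun i => ?_, ?_⟩
    · refine ContDiffAt.add ?_ ?_
      · by_cases h : i = 0
        · simp only [h, if_true]; exact contDiffAt_const
        · simp only [h, if_false]; exact ha _
      · by_cases h : i = m + 1
        · simp only [h, if_true]; exact contDiffAt_const
        · simp only [h, if_false]; exact hb _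
    · filter_upwards [hfe, hae, hbe] with x h1 h2 h3
      rw [h1, h2, h3]
      simp only [mul_add, Finset.sum_add_distrib]
      congr 1
      · rw [Finset.mul_sum, Finset.sum_range_succ' _ (m + 1)]
        simp only [Nat.add_sub_cancel, Nat.add_sub_add_right, if_true, mul_zero, add_zero,
          Nat.succ_ne_zero, if_false]
        exact Finset.sum_congr rfl fun i hi => by ring
      · rw [Finset.mul_sum, Finset.sum_range_succ _ (m + 1)]
        simp only [if_true, mul_zero, add_zero]
        refine Finset.sum_congr rfl fun i hi => ?_
        have hi' : i < m + 1 := by simpa using hi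
        rw [if_neg (by omega), show m + 1 - i = (m - i) + 1 by omega]
        ring

open scoped ComplexConjugate

/-- Functions that are sums of monomials of degree `n` in `ζ`, `conj ζ` with smooth coefficients. -/
inductive ZForm {X : Type} [NormedAddCommGroup X] [NormedSpace ℝ X] (ζ : X → ℂ) (p : X) :
    ℕ → (X → ℂ) → Prop
  | mono (a b n : ℕ) (D : X → ℂ) (hD : ContDiffAt ℝ ∞ D p) (h : a + b = n) :
      ZForm ζ p n (fun q => ζ q ^ a * conj (ζ q) ^ b * D q)
  | add (n : ℕ) (S T : X → ℂ) (hS : ZForm ζ p n S) (hT : ZForm ζ p n T) :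
      ZForm ζ p n (fun q => S q + T q)

namespace ZForm

variable {X : Type} [NormedAddCommGroup X] [NormedSpace ℝ X] {ζ : X → ℂ} {p : X}

lemma congr {n : ℕ} {S T : X → ℂ} (hS : ZForm ζ p n S) (h : ∀ q, T q = S q) : ZForm ζ p n T := by
  rwa [show T = S from funext h]

lemma coef (D : X → ℂ) (hD : ContDiffAt ℝ ∞ D p) : ZForm ζ p 0 D :=
  (mono 0 0 0 D hD rfl).congr (by simp)

lemma base : ZForm ζ p 1 ζ :=
  (mono 1 0 1 (fun _ => 1) contDiffAt_const rfl).congr (by simp)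

lemma base_conj : ZForm ζ p 1 (fun q => conj (ζ q)) :=
  (mono 0 1 1 (fun _ => 1) contDiffAt_const rfl).congr (by simp)

lemma zero (n : ℕ) : ZForm ζ p n (fun _ => 0) :=
  (mono n 0 n (fun _ => 0) contDiffAt_const rfl).congr (by simp)

lemma mul {n m : ℕ} {S T : X → ℂ} (hS : ZForm ζ p n S) (hT : ZForm ζ p m T) :
    ZForm ζ p (n + m) (fun q => S q * T q) := by
  induction hS with
  | mono a b n D hD h =>
    induction hT with
    | mono aa_ bb_ m DD_ hD' hh_ =>
      exact (mono (a + aa_) (b + bb_) (n + m) (fun q => D q * DD_ q) (hD.mul hD') (by omega)).congr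
        (fun q => by ring)
    | add m S T _ _ ihS ihT => exact (add _ _ _ ihS ihT).congr (fun q => by ring)
  | add n S T _ _ ihS ihT => exact (add _ _ _ ihS ihT).congr (fun q => by ring)

lemma cast {n m : ℕ} {S : X → ℂ} (hS : ZForm ζ p n S) (h : n = m) : ZForm ζ p m S := h ▸ hS

lemma pow {n : ℕ} {S : X → ℂ} (hS : ZForm ζ p n S) (l : ℕ) :
    ZForm ζ p (n * l) (fun q => S q ^ l) := by
  induction l with
  | zero => exact (coef (fun _ => 1) contDiffAt_const).congr (by simp)
  | succ l ih => exact (ih.mul hS).congr (fun q => by ring)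

lemma sum {n : ℕ} (s : Finset ℕ) (S : ℕ → X → ℂ) (hS : ∀ i ∈ s, ZForm ζ p n (S i)) :
    ZForm ζ p n (fun q => ∑ i ∈ s, S i q) := by
  classical
  induction s using Finset.induction_on with
  | empty => exact (zero n).congr (by simp)
  | insert i s hi ih =>
    exact (add _ _ _ (hS i (by simp)) (ih fun ii_ h => hS ii_ (by simp [h]))).congr
      (fun q => by rw [Finset.sum_insert hi])

lemma weaken1 (hζ : ContDiffAt ℝ ∞ ζ p) {n m : ℕ} {S : X → ℂ} (hS : ZForm ζ p n S)
    (h : n = m + 1) : ZForm ζ p m S := by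
  induction hS with
  | mono a b n D hD hh_ =>
    rcases a with _ | a
    · obtain ⟨b, rfl⟩ : ∃ bb_, b = bb_ + 1 := ⟨b - 1, by omega⟩
      refine (mono 0 b m (fun q => conj (ζ q) * D q) ?_ (by omega)).congr (fun q => by ring)
      exact (Complex.conjCLE.contDiff.contDiffAt.comp p hζ).mul hD
    · exact (mono a b m (fun q => ζ q * D q) (hζ.mul hD) (by omega)).congr (fun q => by ring)
  | add n S T _ _ ihS ihT => exact add _ _ _ (ihS h) (ihT h)

lemma weaken (hζ : ContDiffAt ℝ ∞ ζ p) {m : ℕ} (d : ℕ) {S : X → ℂ} (hS : ZForm ζ p (m + d) S) :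
    ZForm ζ p m S := by
  induction d with
  | zero => exact hS
  | succ d ih => exact ih (hS.weaken1 hζ (by omega))

/-- The representation of real parts. -/
def Rep (ζ : X → ℂ) (p : X) (j : ℕ) (S : X → ℂ) (Z : Set X) : Prop :=
  ∃ A : X → ℂ × ℂ × ℂ, ContDiffAt ℝ ∞ A p ∧ (∀ q ∈ Z, A q = 0) ∧
    ∀ q, (S q).re = (ζ q ^ j * (ζ q ^ 2 * (A q).1 + ζ q * conj (ζ q) * (A q).2.1
      + conj (ζ q) ^ 2 * (A q).2.2)).re

lemma rep_add {j : ℕ} {S T : X → ℂ} {Z : Set X} (hS : Rep ζ p j S Z) (hT : Rep ζ p j T Z) :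
    Rep ζ p j (fun q => S q + T q) Z := by
  obtain ⟨A, hA, hA0, hAe⟩ := hS
  obtain ⟨B, hB, hB0, hBe⟩ := hT
  refine ⟨fun q => A q + B q, hA.add hB, fun q hq => by simp [hA0 q hq, hB0 q hq], fun q => ?_⟩
  rw [Complex.add_re, hAe, hBe, ← Complex.add_re]
  congr 1
  simp only [Prod.fst_add, Prod.snd_add]
  ring

lemma rep_mono {j : ℕ} (hj : j ≤ 3) {a b : ℕ} (hab : a + b = j + 2) {D : X → ℂ} {Z : Set X}
    (hD : ContDiffAt ℝ ∞ D p) (hZ : ∀ q ∈ Z, D q = 0) :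
    Rep ζ p j (fun q => ζ q ^ a * conj (ζ q) ^ b * D q) Z := by
  -- the case where the exponent of `conj ζ` is at most two
  have main : ∀ (a b : ℕ) (_ : a + b = j + 2) (_ : b ≤ 2) (D : X → ℂ) (_ : ContDiffAt ℝ ∞ D p)
      (_ : ∀ q ∈ Z, D q = 0), Rep ζ p j (fun q => ζ q ^ a * conj (ζ q) ^ b * D q) Z := by
    intro a b hab hb D hD hZ
    have h0 : ContDiffAt ℝ ∞ (fun _ : X => (0 : ℂ)) p := contDiffAt_const
    interval_cases b
    · obtain rfl : a = j + 2 := by omega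
      exact ⟨fun q => (D q, 0, 0), by fun_prop, fun q hq => by simp [hZ q hq],
        fun q => by congr 1; ring⟩
    · obtain rfl : a = j + 1 := by omega
      exact ⟨fun q => (0, D q, 0), by fun_prop, fun q hq => by simp [hZ q hq],
        fun q => by congr 1; ring⟩
    · obtain rfl : a = j := by omega
      exact ⟨fun q => (0, 0, D q), by fun_prop, fun q hq => by simp [hZ q hq],
        fun q => by congr 1; ring⟩
  by_cases hb : b ≤ 2
  · exact main a b hab hb D hD hZ
  · obtain ⟨A, h1, h2, h3⟩ := main b a (by omega) (by omega) (fun q => conj (D q))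
      (Complex.conjCLE.contDiff.contDiffAt.comp p hD) (fun q hq => by simp [hZ q hq])
    refine ⟨A, h1, h2, fun q => ?_⟩
    rw [← h3, ← Complex.conj_re]
    congr 1
    simp only [map_mul, map_pow, Complex.conj_conj]
    ring

lemma rep {j : ℕ} (hj : j ≤ 3) {n : ℕ} {S : X → ℂ} (hS : ZForm ζ p n S) (hn : n = j + 2) :
    Rep ζ p j S ∅ := by
  induction hS with
  | mono a b n D hD h => exact rep_mono hj (by omega) hD (by simp)
  | add n S T _ _ ihS ihT => exact rep_add (ihS hn) (ihT hn)

lemma rep' (hζ : ContDiffAt ℝ ∞ ζ p) {j : ℕ} (hj : j ≤ 3) {n : ℕ} {S : X → ℂ}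
    (hS : ZForm ζ p n S) (hn : n = j + 3) : Rep ζ p j S {q | ζ q = 0} := by
  induction hS with
  | mono a b n D hD h =>
    rcases a with _ | a
    · obtain ⟨b, rfl⟩ : ∃ bb_, b = bb_ + 1 := ⟨b - 1, by omega⟩
      have := rep_mono (ζ := ζ) (Z := {q | ζ q = 0}) hj (a := 0) (b := b) (by omega)
        (D := fun q => conj (ζ q) * D q)
        ((Complex.conjCLE.contDiff.contDiffAt.comp p hζ).mul hD)
        (fun q hq => by
          have hq' : ζ q = 0 := hq
          simp [hq'])
      convert this using 2
      ring
    · have := rep_mono (ζ := ζ) (Z := {q | ζ q = 0}) hj (a := a) (b := b) (by omega)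
        (D := fun q => ζ q * D q) (hζ.mul hD)
        (fun q hq => by
          have hq' : ζ q = 0 := hq
          simp [hq'])
      convert this using 2
      ring
  | add n S T _ _ ihS ihT => exact rep_add (ihS hn) (ihT hn)

end ZForm

/-- The displacement. -/
noncomputable def disp (κ : ℂ) (z : ℂ) (v : ℂ × ℂ × ℂ) : ℂ :=
  κ * (z ^ 2 * v.1 + z * conj z * v.2.1 + conj z ^ 2 * v.2.2)

lemma disp_form (κ : ℂ) (p : ℂ × ℂ × ℂ × ℂ) :
    ZForm (fun q : ℂ × ℂ × ℂ × ℂ => q.1) p 2 (fun q => disp κ q.1 q.2) := by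
  have h1 := ZForm.mono (ζ := fun q : ℂ × ℂ × ℂ × ℂ => q.1) (p := p) 2 0 2 (fun q => κ * q.2.1)
    (by fun_prop) rfl
  have h2 := ZForm.mono (ζ := fun q : ℂ × ℂ × ℂ × ℂ => q.1) (p := p) 1 1 2 (fun q => κ * q.2.2.1)
    (by fun_prop) rfl
  have h3 := ZForm.mono (ζ := fun q : ℂ × ℂ × ℂ × ℂ => q.1) (p := p) 0 2 2 (fun q => κ * q.2.2.2)
    (by fun_prop) rfl
  exact ((h1.add _ _ _ h2).add _ _ _ h3).congr (fun q => by unfold disp; ring)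

lemma higher_form (j : ℕ) (c κ : ℂ) (p : ℂ × ℂ × ℂ × ℂ) :
    ZForm (fun q : ℂ × ℂ × ℂ × ℂ => q.1) p (j + 3) (fun q =>
      c * (q.1 + disp κ q.1 q.2) ^ (j + 1) - c * q.1 ^ (j + 1)
        - c * (j + 1) * q.1 ^ j * disp κ q.1 q.2) := by
  have hS : ZForm (fun q : ℂ × ℂ × ℂ × ℂ => q.1) p (j + 3) (fun q =>
      ∑ i ∈ Finset.range j, c * ((j + 1).choose (i + 2) : ℂ) *
        (disp κ q.1 q.2 ^ (i + 2) * q.1 ^ (j - 1 - i))) := by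
    refine ZForm.sum _ _ fun i hi => ?_
    have hi' : i < j := by simpa using hi
    have h1 := (ZForm.coef (ζ := fun q : ℂ × ℂ × ℂ × ℂ => q.1) (p := p)
      (fun _ => c * ((j + 1).choose (i + 2) : ℂ)) contDiffAt_const).mul
      (((disp_form κ p).pow (i + 2)).mul
        ((ZForm.base (ζ := fun q : ℂ × ℂ × ℂ × ℂ => q.1) (p := p)).pow (j - 1 - i)))
    exact (h1.cast (m := j + 3 + i) (by omega)).weaken contDiffAt_fst i
  refine hS.congr fun q => ?_
  rw [add_comm q.1, add_pow, Finset.sum_range_succ', Finset.sum_range_succ', add_comm]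
  simp only [zero_add, pow_zero, Nat.choose_zero_right, pow_one, Nat.choose_one_right, Nat.sub_zero,
    Nat.add_sub_cancel, mul_add, Finset.mul_sum]
  push_cast
  have : ∀ i ∈ Finset.range j, c * (disp κ q.1 q.2 ^ (i + 1 + 1) * q.1 ^ (j - (i + 1)) *
      ((j + 1).choose (i + 1 + 1) : ℂ)) = c * ((j + 1).choose (i + 2) : ℂ) *
        (disp κ q.1 q.2 ^ (i + 2) * q.1 ^ (j - 1 - i)) := by
    intro i hi
    have hi' : i < j := by simpa using hi
    rw [show j - (i + 1) = j - 1 - i by omega]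
    ring
  rw [Finset.sum_congr rfl this]
  ring

lemma core (j : ℕ) (hj : j ≤ 3) (c : ℂ) (hc : c ≠ 0) (S : ℂ → ℂ)
    (hS : ZForm (fun z : ℂ => z) 0 (j + 2) S) :
    ∃ φ : ℂ → ℂ, ContDiffAt ℝ ∞ φ 0 ∧ φ 0 = 0 ∧
      HasFDerivAt φ (ContinuousLinearMap.id ℝ ℂ) 0 ∧
      ∀ᶠ z in 𝓝 (0 : ℂ), (c * φ z ^ (j + 1)).re = (c * z ^ (j + 1)).re + (S z).re := by
  obtain ⟨A, hA, -, hAe⟩ := hS.rep hj rfl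
  have hj1 : (j + 1 : ℂ) ≠ 0 := by exact_mod_cast Nat.succ_ne_zero j
  set κ : ℂ := 1 / (c * (j + 1)) with hκ
  obtain ⟨e, he, he0, hee⟩ := (higher_form j c κ (0, A 0)).rep' contDiffAt_fst hj rfl
  let G : ℂ × ℂ × ℂ × ℂ → ℂ × ℂ × ℂ := fun q => q.2 + e q - A q.1
  have hG : ContDiffAt ℝ ∞ G (0, A 0) := by
    have : ContDiffAt ℝ ∞ (fun q : ℂ × ℂ × ℂ × ℂ => A q.1) (0, A 0) :=
      ContDiffAt.comp (0, A 0) (g := A) (f := fun q : ℂ × ℂ × ℂ × ℂ => q.1) hA contDiffAt_fst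
    exact (contDiffAt_snd.add he).sub this
  have hcomp : fderiv ℝ G (0, A 0) ∘L .inr ℝ ℂ (ℂ × ℂ × ℂ) = ContinuousLinearMap.id ℝ _ := by
    have h1 : HasFDerivAt (fun v : ℂ × ℂ × ℂ => G (0, v))
        (fderiv ℝ G (0, A 0) ∘L .inr ℝ ℂ (ℂ × ℂ × ℂ)) (A 0) :=
      HasFDerivAt.comp (A 0) (g := G) (f := fun v : ℂ × ℂ × ℂ => ((0 : ℂ), v))
        (hG.differentiableAt (by simp)).hasFDerivAt (hasFDerivAt_prodMk_right 0 (A 0))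
    have h2 : (fun v : ℂ × ℂ × ℂ => G (0, v)) = fun v => v - A 0 := by
      funext v
      simp only [G]
      rw [he0 (0, v) rfl, add_zero]
    rw [h2] at h1
    exact h1.unique ((hasFDerivAt_id (A 0)).sub_const (A 0))
  have hinv : (fderiv ℝ G (0, A 0) ∘L .inr ℝ ℂ (ℂ × ℂ × ℂ)).IsInvertible := by
    rw [hcomp]
    exact ⟨ContinuousLinearEquiv.refl ℝ _, rfl⟩
  have hn : (∞ : WithTop ℕ∞) ≠ 0 := by simp
  set v := hG.implicitFunction hn hinv with hv
  have hvs : ContDiffAt ℝ ∞ v 0 := hG.contDiffAt_implicitFunction hn hinv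
  have hve : ∀ᶠ z in 𝓝 (0 : ℂ), G (z, v z) = G (0, A 0) :=
    hG.eventually_apply_implicitFunction hn hinv
  have hG0 : G (0, A 0) = 0 := by
    simp only [G]
    rw [he0 (0, A 0) rfl]
    simp
  have hconj : ContDiffAt ℝ ∞ (fun z : ℂ => conj z) 0 := Complex.conjCLE.contDiff.contDiffAt
  refine ⟨fun z => z + disp κ z (v z), ?_, by simp [disp], ?_, ?_⟩
  · unfold disp
    fun_prop
  · have hz : HasFDerivAt (fun z : ℂ => z) (ContinuousLinearMap.id ℝ ℂ) 0 := hasFDerivAt_id 0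
    have hflat : ∀ f g : ℂ → ℂ, ContDiffAt ℝ ∞ f 0 → ContDiffAt ℝ ∞ g 0 → f 0 = 0 → g 0 = 0 →
        HasFDerivAt (fun z => f z * g z) (0 : ℂ →L[ℝ] ℂ) 0 := by
      intro f g hf hg hf0 hg0
      have := (hf.differentiableAt hn).hasFDerivAt.mul (hg.differentiableAt hn).hasFDerivAt
      refine this.congr_fderiv ?_
      rw [hf0, hg0]
      simp
    have h1 := hflat (fun z => z) (fun z => κ * (z * (v z).1 + conj z * (v z).2.1))
      contDiffAt_id (by fun_prop) rfl (by simp)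
    have h2 := hflat (fun z => conj z) (fun z => κ * (conj z * (v z).2.2))
      hconj (by fun_prop) (by simp) (by simp)
    have h3 := (hz.add h1).add h2
    refine (h3.congr_fderiv (by simp)).congr_of_eventuallyEq (Eventually.of_forall fun z => ?_)
    simp only [disp, Pi.add_apply]
    ring
  · filter_upwards [hve] with z hz
    rw [hG0] at hz
    have hz' : v z + e (z, v z) = A z := by simpa [G, sub_eq_zero] using hz
    have h1 := hee (z, v z)
    have h2 : c * (j + 1) * z ^ j * disp κ z (v z) = z ^ j * (z ^ 2 * (v z).1
        + z * conj z * (v z).2.1 + conj z ^ 2 * (v z).2.2) := by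
      unfold disp
      rw [hκ]
      field_simp
    rw [hAe, ← hz']
    simp only [Complex.sub_re, h2] at h1
    simp only [Prod.fst_add, Prod.snd_add]
    have h4 : ∀ a b d aa_ bb_ dd_ : ℂ, z ^ j * (z ^ 2 * (a + aa_) + z * conj z * (b + bb_)
        + conj z ^ 2 * (d + dd_)) = z ^ j * (z ^ 2 * a + z * conj z * b + conj z ^ 2 * d)
          + z ^ j * (z ^ 2 * aa_ + z * conj z * bb_ + conj z ^ 2 * dd_) := by intros; ring
    rw [h4, Complex.add_re]
    linarith

lemma right_equiv_of_complex (k : ℕ) (hk1 : 1 ≤ k) (hk4 : k ≤ 4) (c : ℂ) (hc : c ≠ 0)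
    (H R : ℝ × ℝ → ℝ) (hH : ∀ q : ℝ × ℝ, H q = (c * ((q.1 : ℂ) + q.2 * Complex.I) ^ k).re)
    (hRs : ContDiffAt ℝ ∞ R 0) (hRm : VanishTo (k + 1) R) :
    RightEquiv H (fun q => H q + R q) := by
  obtain ⟨j, rfl⟩ : ∃ j, k = j + 1 := ⟨k - 1, by omega⟩
  obtain ⟨a, ha, hae⟩ := hadamard_s15 _ R hRs hRm
  let E := Complex.equivRealProdCLM
  have hE0 : E 0 = 0 := map_zero E
  have hE0' : E.symm 0 = 0 := map_zero E.symm
  have hES : ∀ q, E.symm q = (q.1 : ℂ) + q.2 * Complex.I := Complex.equivRealProdCLM_symm_apply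
  let S : ℂ → ℂ := fun z => ∑ i ∈ Finset.range (j + 1 + 1 + 1),
    ((z + conj z) ^ i * ((z + -conj z) ^ (j + 1 + 1 - i))) *
      ((1 / 2) ^ i * (1 / (2 * Complex.I)) ^ (j + 1 + 1 - i) * (a i (E z) : ℂ))
  have hS : ZForm (fun z : ℂ => z) 0 (j + 2) S := by
    refine ZForm.sum _ _ fun i hi => ?_
    have hi' : i < j + 1 + 1 + 1 := by simpa using hi
    have hb := ZForm.base (ζ := fun z : ℂ => z) (p := 0)
    have hb' := ZForm.base_conj (ζ := fun z : ℂ => z) (p := 0)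
    have hn := ZForm.mul (ZForm.coef (ζ := fun z : ℂ => z) (p := 0) (fun _ => -1) contDiffAt_const)
      hb'
    have h1 := (hb.add _ _ _ hb').pow i
    have h2 := ((hb.add _ _ _ ((hn.cast (zero_add 1)).congr
      (T := fun z => -conj z) (fun z => by ring))).pow (j + 1 + 1 - i))
    have hai : ContDiffAt ℝ ∞ (fun z : ℂ => (a i (E z) : ℂ)) 0 := by
      have h3 : ContDiffAt ℝ ∞ (fun z : ℂ => a i (E z)) 0 :=
        ContDiffAt.comp (0 : ℂ) (g := a i) (f := fun z : ℂ => E z) (by rw [hE0]; exact ha i)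
          E.contDiff.contDiffAt
      exact Complex.ofRealCLM.contDiff.contDiffAt.comp (0 : ℂ) h3
    have h4 := (h1.mul h2).mul (ZForm.coef (ζ := fun z : ℂ => z) (p := 0)
      (fun z => (1 / 2) ^ i * (1 / (2 * Complex.I)) ^ (j + 1 + 1 - i) * (a i (E z) : ℂ))
      (contDiffAt_const.mul hai))
    exact h4.cast (by omega)
  have hSR : ∀ᶠ q in 𝓝 (0 : ℝ × ℝ), (S (E.symm q)).re = R q := by
    filter_upwards [hae] with q hq
    rw [hq, ← Complex.ofReal_re (∑ i ∈ _, _)]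
    congr 1
    push_cast
    refine Finset.sum_congr rfl fun i _ => ?_
    have e1 : E.symm q + conj (E.symm q) = 2 * q.1 := by
      rw [hES]; simp; ring
    have e2 : E.symm q + -conj (E.symm q) = 2 * Complex.I * q.2 := by
      rw [hES]; simp; ring
    rw [e1, e2, E.apply_symm_apply]
    have e3 : (2 * Complex.I * (q.2 : ℂ)) * (1 / (2 * Complex.I)) = q.2 := by
      have := Complex.I_ne_zero
      field_simp
    have e4 : (2 * (q.1 : ℂ)) * (1 / 2) = q.1 := by ring
    rw [← e3, ← e4]
    conv_rhs => rw [mul_pow (2 * (q.1 : ℂ)), mul_pow (2 * Complex.I * (q.2 : ℂ))]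
    rw [e3, e4]
    ring
  obtain ⟨φ, hφ, hφ0, hφ', hφe⟩ := core j (by omega) c hc S hS
  have hn : (∞ : WithTop ℕ∞) ≠ 0 := by simp
  have hst : HasStrictFDerivAt φ ((ContinuousLinearEquiv.refl ℝ ℂ : ℂ ≃L[ℝ] ℂ) : ℂ →L[ℝ] ℂ) 0 :=
    hφ.hasStrictFDerivAt' (by exact hφ') hn
  have hf' : HasFDerivAt φ ((ContinuousLinearEquiv.refl ℝ ℂ : ℂ ≃L[ℝ] ℂ) : ℂ →L[ℝ] ℂ) 0 := hφ'
  let ψ := hφ.localInverse hf' hn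
  have hψ : ContDiffAt ℝ ∞ ψ 0 := by
    have := hφ.to_localInverse hf' hn
    rwa [hφ0] at this
  have hψ0 : ψ 0 = 0 := by
    have := hφ.localInverse_apply_image hf' hn
    rwa [hφ0] at this
  have hl : ∀ᶠ z in 𝓝 (0 : ℂ), ψ (φ z) = z := hst.eventually_left_inverse
  have hr : ∀ᶠ z in 𝓝 (0 : ℂ), φ (ψ z) = z := by
    have := hst.eventually_right_inverse
    rwa [hφ0] at this
  have htend : Tendsto E.symm (𝓝 0) (𝓝 0) := by
    have := E.symm.continuous.tendsto 0
    rwa [hE0'] at this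
  have hconj (f : ℂ → ℂ) (hf : ContDiffAt ℝ ∞ f 0) :
      ContDiffAt ℝ ∞ (fun q => E (f (E.symm q))) 0 := by
    refine E.contDiff.contDiffAt.comp (0 : ℝ × ℝ) ?_
    exact ContDiffAt.comp (0 : ℝ × ℝ) (g := f) (f := fun q => E.symm q) (by rwa [hE0'])
      E.symm.contDiff.contDiffAt
  refine ⟨fun q => E (φ (E.symm q)), fun q => E (ψ (E.symm q)), hconj φ hφ, hconj ψ hψ,
    by simp only [hE0', hφ0, hE0], by simp only [hE0', hψ0, hE0], ?_, ?_, ?_⟩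
  · filter_upwards [htend.eventually hl] with q hq
    simp [hq]
  · filter_upwards [htend.eventually hr] with q hq
    simp [hq]
  · filter_upwards [htend.eventually hφe, hSR] with q hq hq2
    simp only [Function.comp]
    rw [hH, hH, ← hES, ← hES, E.symm_apply_apply, hq, hq2]

lemma eq_sum_of_homog (k : ℕ) (h : MvPolynomial (Fin 2) ℝ) (hhom : h.IsHomogeneous k) :
    ∃ d : ℕ → ℝ, h = ∑ i ∈ Finset.range (k + 1), C (d i) * X 0 ^ i * X 1 ^ (k - i) := by
  refine ⟨fun i => coeff (Finsupp.single 0 i + Finsupp.single 1 (k - i)) h, ?_⟩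
  have hm (i : ℕ) (r : ℝ) : (C r * X 0 ^ i * X 1 ^ (k - i) : MvPolynomial (Fin 2) ℝ) =
      monomial (Finsupp.single 0 i + Finsupp.single 1 (k - i)) r := by
    rw [X_pow_eq_monomial, X_pow_eq_monomial, C_mul_monomial, monomial_mul, mul_one, mul_one]
  simp only [hm]
  ext m
  rw [coeff_sum]
  simp only [coeff_monomial]
  by_cases hdeg : m.degree = k
  · have hsum : m 0 + m 1 = k := by
      rw [← hdeg, Finsupp.degree_eq_sum, Fin.sum_univ_two]
    have hme : Finsupp.single 0 (m 0) + Finsupp.single 1 (k - m 0) = m := by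
      ext i
      fin_cases i
      · simp
      · simp; omega
    rw [Finset.sum_eq_single (m 0)]
    · rw [hme, if_pos rfl]
    · intro i _ hi
      rw [if_neg]
      intro hh
      apply hi
      have := DFunLike.congr_fun hh 0
      simpa using this
    · intro hh
      exact absurd (Finset.mem_range.2 (by omega)) hh
  · rw [hhom.coeff_eq_zero hdeg, Finset.sum_eq_zero]
    intro i hi
    rw [if_neg]
    intro hh
    apply hdeg
    have hi' : i < k + 1 := by simpa using hi
    rw [← hh, Finsupp.degree_eq_sum, Fin.sum_univ_two]
    simp
    omega

lemma harmonic_form (k : ℕ) (hk1 : 1 ≤ k) (hk4 : k ≤ 4)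
    (h : MvPolynomial (Fin 2) ℝ) (hne : h ≠ 0)
    (hhom : h.IsHomogeneous k) (hharm : pLap h = 0) :
    ∃ c : ℂ, c ≠ 0 ∧ ∀ q : ℝ × ℝ,
      toFun2 h q = (c * ((q.1 : ℂ) + q.2 * Complex.I) ^ k).re := by
  obtain ⟨d, hd⟩ := eq_sum_of_homog k h hhom
  have hL (x y : ℝ) : eval ![x, y] (pLap h) = 0 := by rw [hharm]; simp
  have e10 := hL 1 0
  have e01 := hL 0 1
  have e11 := hL 1 1
  have h01 : (0 : Fin 2) ≠ 1 := by decide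
  have hp (i : Fin 2) (n : ℕ) : pderiv i ((n : ℕ) : MvPolynomial (Fin 2) ℝ) = 0 :=
    Derivation.map_natCast _ n
  have hp2 (i : Fin 2) : pderiv i (2 : MvPolynomial (Fin 2) ℝ) = 0 := by exact_mod_cast hp i 2
  have hp3 (i : Fin 2) : pderiv i (3 : MvPolynomial (Fin 2) ℝ) = 0 := by exact_mod_cast hp i 3
  have hp4 (i : Fin 2) : pderiv i (4 : MvPolynomial (Fin 2) ℝ) = 0 := by exact_mod_cast hp i 4
  interval_cases k
  all_goals
    simp only [Finset.sum_range_succ, Finset.sum_range_zero] at hd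
    norm_num at hd
    rw [hd] at e10 e01 e11
    simp only [pLap, map_add, Derivation.leibniz, Derivation.leibniz_pow, pderiv_C, pderiv_X_self,
      pderiv_X_of_ne h01, pderiv_X_of_ne h01.symm, smul_eq_mul, nsmul_eq_mul, map_mul, map_pow,
      eval_X, eval_C, map_zero, map_natCast, map_one, pderiv_one] at e10 e01 e11
    norm_num [hp2, hp3, hp4] at e10 e01 e11
  · have _u := hL
    refine ⟨⟨d 1, -d 0⟩, fun hc => hne ?_, fun q => ?_⟩
    · have hre := congrArg Complex.re hc
      have him := congrArg Complex.im hc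
      simp only [Complex.zero_re, Complex.zero_im] at hre him
      have z0 : d 0 = 0 := by linarith
      have z1 : d 1 = 0 := by linarith
      rw [hd]
      simp [z0, z1]
    · rw [hd]
      simp [toFun2, pow_succ]
      try ring
  · have r0 : d 0 = -d 2 := by linarith
    refine ⟨⟨d 2, -d 1 / 2⟩, fun hc => hne ?_, fun q => ?_⟩
    · have hre := congrArg Complex.re hc
      have him := congrArg Complex.im hc
      simp only [Complex.zero_re, Complex.zero_im] at hre him
      have z0 : d 0 = 0 := by linarith
      have z1 : d 1 = 0 := by linarith
      have z2 : d 2 = 0 := by linarith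
      rw [hd]
      simp [z0, z1, z2]
    · rw [hd]
      simp [toFun2, pow_succ]
      rw [r0]; ring
  · have r1 : d 1 = -3 * d 3 := by linarith
    have r2 : d 2 = -3 * d 0 := by linarith
    refine ⟨⟨d 3, d 0⟩, fun hc => hne ?_, fun q => ?_⟩
    · have hre := congrArg Complex.re hc
      have him := congrArg Complex.im hc
      simp only [Complex.zero_re, Complex.zero_im] at hre him
      have z0 : d 0 = 0 := by linarith
      have z1 : d 1 = 0 := by linarith
      have z2 : d 2 = 0 := by linarith
      have z3 : d 3 = 0 := by linarith
      rw [hd]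
      simp [z0, z1, z2, z3]
    · rw [hd]
      simp [toFun2, pow_succ]
      rw [r1, r2]; ring
  · have r2 : d 2 = -6 * d 4 := by linarith
    have r0 : d 0 = d 4 := by linarith
    have r1 : d 1 = -d 3 := by linarith
    refine ⟨⟨d 4, -d 3 / 4⟩, fun hc => hne ?_, fun q => ?_⟩
    · have hre := congrArg Complex.re hc
      have him := congrArg Complex.im hc
      simp only [Complex.zero_re, Complex.zero_im] at hre him
      have z0 : d 0 = 0 := by linarith
      have z1 : d 1 = 0 := by linarith
      have z2 : d 2 = 0 := by linarith
      have z3 : d 3 = 0 := by linarith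
      have z4 : d 4 = 0 := by linarith
      rw [hd]
      simp [z0, z1, z2, z3, z4]
    · rw [hd]
      simp [toFun2, pow_succ]
      rw [r0, r1, r2]; ring

/-- For `1 ≤ k ≤ 4`, every nonzero homogeneous harmonic polynomial `h` of
degree `k` is `k`-determined: for every smooth germ `R ∈ m₂^{k+1}`, the germs `h` and `h + R`
are right equivalent. -/
theorem low_degree_harmonic_is_k_determined
    (k : ℕ) (hk1 : 1 ≤ k) (hk4 : k ≤ 4)
    (h : MvPolynomial (Fin 2) ℝ) (hne : h ≠ 0)
    (hhom : h.IsHomogeneous k) (hharm : pLap h = 0)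
    (R : ℝ × ℝ → ℝ) (hRs : ContDiffAt ℝ (⊤ : ℕ∞) R 0) (hRm : VanishTo (k + 1) R) :
    RightEquiv (toFun2 h) (fun q => toFun2 h q + R q) := by
  obtain ⟨c, hc, hH⟩ := harmonic_form k hk1 hk4 h hne hhom hharm
  exact right_equiv_of_complex k hk1 hk4 c hc (toFun2 h) R hH hRs hRm
end
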